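/- arXiv:2209.14177 — 5 statements merged into one kernel-verified Lean document; each statement's English description precedes it below -/
import Mathlib

section
/- The liminf over n of n^{-2} f^{(3)}(n; 6, 4) is at least 7/36. -/
open Finset Filter

/-- An `r`-graph is `(s,k)`-free if it has no `k` distinct edges spanning at most `s` vertices. -/
def IsFree {V : Type*} [DecidableEq V] (G : Finset (Finset V)) (s k : ℕ) : Prop :=
  ¬ ∃ S ⊆ G, S.card = k ∧ (S.sup id).card ≤ s

/-- `exNum r n s k` is the maximum number of edges of an `(s,k)`-free `r`-uniform
hypergraph on `n` vertices, i.e. `f^{(r)}(n; s, k)`. -/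
noncomputable def exNum (r n s k : ℕ) : ℕ :=
  sSup {m : ℕ | ∃ G : Finset (Finset (Fin n)),
    (∀ e ∈ G, e.card = r) ∧ IsFree G s k ∧ G.card = m}

namespace BES64

/-- The nine-vertex gadget: a core triple and three pairs of triples attached to it. -/
def gadget : Finset (Finset (Fin 9)) :=
  {{0, 1, 2}, {3, 4, 1}, {3, 4, 2}, {5, 6, 0}, {5, 6, 2}, {7, 8, 0}, {7, 8, 1}}

/-- Three positions forming an edge of the gadget. -/
def Tri (i j k : Fin 9) : Prop := ({i, j, k} : Finset (Fin 9)) ∈ gadget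

instance (i j k : Fin 9) : Decidable (Tri i j k) := inferInstanceAs (Decidable (_ ∈ _))

/-- Two distinct positions covered by an edge of the gadget. -/
def Shadow (i j : Fin 9) : Prop := i ≠ j ∧ ∃ d ∈ gadget, i ∈ d ∧ j ∈ d

instance (i j : Fin 9) : Decidable (Shadow i j) := inferInstanceAs (Decidable (_ ∧ _))

/-- Pairs of positions which must not be covered by two edges outside the gadget. -/
def Claim (i j : Fin 9) : Prop :=
  Shadow i j ∨ ({i, j} : Finset (Fin 9)) ∈
    ({{3, 0}, {4, 0}, {5, 1}, {6, 1}, {7, 2}, {8, 2}} : Finset (Finset (Fin 9)))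

instance (i j : Fin 9) : Decidable (Claim i j) := inferInstanceAs (Decidable (_ ∨ _))

lemma card_of_mem_gadget : ∀ d ∈ gadget, d.card = 3 := by decide +kernel

lemma card_gadget : gadget.card = 7 := by decide +kernel

lemma Tri.shadow : ∀ {i j k : Fin 9}, Tri i j k → Shadow i j ∧ Shadow i k ∧ Shadow j k := by
  decide +kernel

lemma Tri.rotate : ∀ {i j k : Fin 9}, Tri i j k → Tri j k i := by decide +kernel

lemma Tri.swap : ∀ {i j k : Fin 9}, Tri i j k → Tri i k j := by decide +kernel

lemma Shadow.symm : ∀ {i j : Fin 9}, Shadow i j → Shadow j i := by decide +kernel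

lemma Claim.symm : ∀ {i j : Fin 9}, Claim i j → Claim j i := by decide +kernel

lemma Shadow.ne {i j : Fin 9} (h : Shadow i j) : i ≠ j := h.1

lemma shadow_of_mem {d : Finset (Fin 9)} (hd : d ∈ gadget) {i j : Fin 9} (hi : i ∈ d) (hj : j ∈ d)
    (h : i ≠ j) : Shadow i j := ⟨h, d, hd, hi, hj⟩

lemma card_filter_testBit_four : ∀ m < 512, (univ.filter (fun i : Fin 9 => m.testBit i)).card = 4 →
    (gadget.filter (fun d => ∀ i ∈ d, m.testBit (Fin.val i))).card ≤ 2 := by decide +kernel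

lemma card_filter_testBit_six : ∀ m < 512, (univ.filter (fun i : Fin 9 => m.testBit i)).card = 6 →
    (gadget.filter (fun d => ∀ i ∈ d, m.testBit (Fin.val i))).card ≤ 3 := by decide +kernel

set_option synthInstance.maxSize 2000 in
set_option synthInstance.maxHeartbeats 400000 in
lemma claim_of_testBit_five : ∀ m < 512, (univ.filter (fun i : Fin 9 => m.testBit i)).card = 5 →
    3 ≤ (gadget.filter (fun d => ∀ i ∈ d, m.testBit (Fin.val i))).card →
    ∀ i : Fin 9, m.testBit i → ∀ j : Fin 9, m.testBit j → i ≠ j → Claim i j := by decide +kernel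

set_option synthInstance.maxSize 2000 in
set_option synthInstance.maxHeartbeats 400000 in
lemma claim_of_testBit_six : ∀ m < 512, (univ.filter (fun i : Fin 9 => m.testBit i)).card = 6 →
    3 ≤ (gadget.filter (fun d => ∀ i ∈ d, m.testBit (Fin.val i))).card →
    ∀ i j : Fin 9, m.testBit i ∧ m.testBit j ∧ i ≠ j →
    ∀ k : Fin 9, m.testBit k ∧ i ≠ k ∧ j ≠ k → Claim i j ∨ Claim i k ∨ Claim j k := by
  decide +kernel

lemma exists_testBit (U : Finset (Fin 9)) : ∃ m < 512, ∀ i : Fin 9, m.testBit i = true ↔ i ∈ U := by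
  refine ⟨Nat.ofBits (fun i : Fin 9 => decide (i ∈ U)), Nat.ofBits_lt_two_pow _, fun i => ?_⟩
  rw [Nat.testBit_ofBits_lt _ _ i.2]
  simp

lemma filter_testBit {m : ℕ} {U : Finset (Fin 9)} (h : ∀ i : Fin 9, m.testBit i = true ↔ i ∈ U) :
    univ.filter (fun i : Fin 9 => m.testBit i) = U ∧
      gadget.filter (fun d => ∀ i ∈ d, m.testBit (Fin.val i)) = gadget.filter (· ⊆ U) := by
  constructor
  · ext i; simp [h]
  · refine filter_congr fun d _ => ?_
    simp [h, subset_iff]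

lemma seven_le_card_sup_four {S : Finset (Finset (Fin 9))} (hS : S ⊆ gadget) (h : S.card = 4) :
    7 ≤ (S.sup id).card := by
  by_contra! hlt
  obtain ⟨U, hU, hU6⟩ := exists_superset_card_eq (s := S.sup id) (n := 6) (by omega) (by simp)
  obtain ⟨m, hm, hmU⟩ := exists_testBit U
  have h6 := card_filter_testBit_six m hm
  rw [(filter_testBit hmU).1, (filter_testBit hmU).2] at h6
  have : S ⊆ gadget.filter (· ⊆ U) := fun d hd => mem_filter.2
    ⟨hS hd, (le_sup (f := id) hd).trans hU⟩
  have := card_le_card this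
  have := h6 hU6
  omega

lemma seven_le_card_sup_three {S : Finset (Finset (Fin 9))} (hS : S ⊆ gadget) (h : S.card = 3)
    {W : Finset (Fin 9)} (hW : W ⊆ S.sup id)
    (hWC : ∀ i ∈ W, ∀ j ∈ W, i ≠ j → ¬ Claim i j) :
    7 ≤ (S.sup id).card ∨ W.card + 4 ≤ (S.sup id).card := by
  by_contra! hlt
  have key : ∀ U : Finset (Fin 9), S.sup id ⊆ U → 3 ≤ (gadget.filter (· ⊆ U)).card := by
    intro U hU
    rw [← h]
    exact card_le_card fun d hd => mem_filter.2 ⟨hS hd, (le_sup (f := id) hd).trans hU⟩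
  have h5 : 5 ≤ (S.sup id).card := by
    by_contra! hlt
    obtain ⟨U, hU, hU4⟩ := exists_superset_card_eq (s := S.sup id) (n := 4) (by omega) (by simp)
    obtain ⟨m, hm, hmU⟩ := exists_testBit U
    have h4 := card_filter_testBit_four m hm
    rw [(filter_testBit hmU).1, (filter_testBit hmU).2] at h4
    have := key U hU
    have := h4 hU4
    omega
  obtain ⟨m, hm, hmU⟩ := exists_testBit (S.sup id)
  have h5' := claim_of_testBit_five m hm
  have h6' := claim_of_testBit_six m hm
  rw [(filter_testBit hmU).1, (filter_testBit hmU).2] at h5' h6'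
  simp only [hmU] at h5' h6'
  have k := key _ subset_rfl
  rcases (show (S.sup id).card = 5 ∨ (S.sup id).card = 6 by omega) with h5 | h6
  · obtain ⟨i, hi, j, hj, hij⟩ := one_lt_card.1 (show 1 < W.card by omega)
    exact hWC i hi j hj hij (h5' h5 k i (hW hi) j (hW hj) hij)
  · obtain ⟨i, hi, j, hj, l, hl, hij, hil, hjl⟩ := two_lt_card.1 (show 2 < W.card by omega)
    rcases h6' h6 k i j ⟨hW hi, hW hj, hij⟩ l ⟨hW hl, hil, hjl⟩ with h | h | h
    exacts [hWC _ hi _ hj hij h, hWC _ hi _ hl hil h, hWC _ hj _ hl hjl h]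

lemma inter_of_mem_gadget : ∀ d ∈ gadget, ∀ d' ∈ gadget, d ≠ d' → 2 ≤ (d ∩ d').card →
    (d ∩ d').card = 2 ∧ ∀ i ∈ d ∪ d', ∀ j ∈ d ∪ d', i ≠ j → Shadow i j := by decide +kernel

section Combinatorics

variable {V : Type*} [DecidableEq V]

lemma inter_of_three {E₁ E₂ E₃ : Finset V} (h₁ : E₁.card = 3) (h₂ : E₂.card = 3)
    (h₃ : E₃.card = 3) (h₁₂ : (E₁ ∩ E₂).card ≤ 1) (h₁₃ : (E₁ ∩ E₃).card ≤ 1)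
    (h₂₃ : (E₂ ∩ E₃).card ≤ 1) (hU : (E₁ ∪ E₂ ∪ E₃).card ≤ 6) :
    (E₁ ∩ E₂).card = 1 ∧ (E₁ ∩ E₃).card = 1 ∧ (E₂ ∩ E₃).card = 1 ∧
      ∀ x, x ∈ E₁ → x ∈ E₂ → x ∉ E₃ := by
  have a := card_union_add_card_inter E₁ E₂
  have b := card_union_add_card_inter (E₁ ∪ E₂) E₃
  have c := card_union_add_card_inter (E₁ ∩ E₃) (E₂ ∩ E₃)
  rw [← union_inter_distrib_right] at c
  have h0 : (E₁ ∩ E₃ ∩ (E₂ ∩ E₃)).card = 0 := by omega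
  refine ⟨by omega, by omega, by omega, fun x h1 h2 h3 => ?_⟩
  have : x ∈ E₁ ∩ E₃ ∩ (E₂ ∩ E₃) := by simp [h1, h2, h3]
  rw [card_eq_zero.1 h0] at this
  simp at this

lemma eq_triple {E : Finset V} (h : E.card = 3) {a b c : V} (ha : a ∈ E) (hb : b ∈ E) (hc : c ∈ E)
    (hab : a ≠ b) (hac : a ≠ c) (hbc : b ≠ c) : E = {a, b, c} := by
  refine (eq_of_subset_of_card_le ?_ ?_).symm
  · intro x hx
    simp only [mem_insert, mem_singleton] at hx
    rcases hx with rfl | rfl | rfl <;> assumption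
  · rw [h, card_eq_three.2 ⟨a, b, c, hab, hac, hbc, rfl⟩]

/-- Four triples on six points, any two of which meet in at most one point, form a Pasch
configuration. -/
lemma exists_pasch {E₁ E₂ E₃ E₄ : Finset V} (h₁ : E₁.card = 3) (h₂ : E₂.card = 3)
    (h₃ : E₃.card = 3) (h₄ : E₄.card = 3) (h₁₂ : (E₁ ∩ E₂).card ≤ 1) (h₁₃ : (E₁ ∩ E₃).card ≤ 1)
    (h₁₄ : (E₁ ∩ E₄).card ≤ 1) (h₂₃ : (E₂ ∩ E₃).card ≤ 1) (h₂₄ : (E₂ ∩ E₄).card ≤ 1)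
    (h₃₄ : (E₃ ∩ E₄).card ≤ 1) (hU : (E₁ ∪ E₂ ∪ E₃ ∪ E₄).card ≤ 6) :
    ∃ a b c d e f : V, [a, b, c, d, e, f].Nodup ∧ E₁ = {a, b, c} ∧ E₂ = {a, d, e} ∧
      E₃ = {b, d, f} ∧ E₄ = {c, e, f} := by
  have t₁₂₃ := inter_of_three h₁ h₂ h₃ h₁₂ h₁₃ h₂₃
    ((card_le_card (by grind)).trans hU)
  have t₁₂₄ := inter_of_three h₁ h₂ h₄ h₁₂ h₁₄ h₂₄
    ((card_le_card (by grind)).trans hU)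
  have t₁₃₄ := inter_of_three h₁ h₃ h₄ h₁₃ h₁₄ h₃₄
    ((card_le_card (by grind)).trans hU)
  have t₂₃₄ := inter_of_three h₂ h₃ h₄ h₂₃ h₂₄ h₃₄
    ((card_le_card (by grind)).trans hU)
  have key : ∀ {X Y : Finset V}, (X ∩ Y).card = 1 → ∃ a, a ∈ X ∧ a ∈ Y := by
    intro X Y h
    obtain ⟨a, ha⟩ := card_pos.1 (by omega : 0 < (X ∩ Y).card)
    exact ⟨a, (mem_inter.1 ha).1, (mem_inter.1 ha).2⟩
  obtain ⟨a, a1, a2⟩ := key t₁₂₃.1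
  obtain ⟨b, b1, b3⟩ := key t₁₂₃.2.1
  obtain ⟨c, c1, c4⟩ := key t₁₂₄.2.1
  obtain ⟨d, d2, d3⟩ := key t₁₂₃.2.2.1
  obtain ⟨e, e2, e4⟩ := key t₁₂₄.2.2.1
  obtain ⟨f, f3, f4⟩ := key t₁₃₄.2.2.1
  have n₁₂₃ := t₁₂₃.2.2.2
  have n₁₂₄ := t₁₂₄.2.2.2
  have n₁₃₄ := t₁₃₄.2.2.2
  have n₂₃₄ := t₂₃₄.2.2.2
  have hab : a ≠ b := by rintro rfl; exact n₁₂₃ _ a1 a2 b3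
  have hac : a ≠ c := by rintro rfl; exact n₁₂₄ _ a1 a2 c4
  have had : a ≠ d := by rintro rfl; exact n₁₂₃ _ a1 a2 d3
  have hae : a ≠ e := by rintro rfl; exact n₁₂₄ _ a1 a2 e4
  have haf : a ≠ f := by rintro rfl; exact n₁₂₃ _ a1 a2 f3
  have hbc : b ≠ c := by rintro rfl; exact n₁₃₄ _ b1 b3 c4
  have hbd : b ≠ d := by rintro rfl; exact n₁₂₃ _ b1 d2 b3
  have hbe : b ≠ e := by rintro rfl; exact n₁₂₃ _ b1 e2 b3
  have hbf : b ≠ f := by rintro rfl; exact n₁₃₄ _ b1 b3 f4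
  have hcd : c ≠ d := by rintro rfl; exact n₁₂₄ _ c1 d2 c4
  have hce : c ≠ e := by rintro rfl; exact n₁₂₄ _ c1 e2 c4
  have hcf : c ≠ f := by rintro rfl; exact n₁₃₄ _ c1 f3 c4
  have hde : d ≠ e := by rintro rfl; exact n₂₃₄ _ d2 d3 e4
  have hdf : d ≠ f := by rintro rfl; exact n₂₃₄ _ d2 d3 f4
  have hef : e ≠ f := by rintro rfl; exact n₂₃₄ _ e2 f3 e4
  refine ⟨a, b, c, d, e, f, by simp [*], eq_triple h₁ a1 b1 c1 hab hac hbc,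
    eq_triple h₂ a2 d2 e2 had hae hde, eq_triple h₃ b3 d3 f3 hbd hbf hdf,
    eq_triple h₄ c4 e4 f4 hce hcf hef⟩

end Combinatorics

section Copies

variable {V C : Type*} [DecidableEq V] {v : C → Fin 9 → V}

/-- The edge of the copy `p.1` which corresponds to the gadget edge `p.2`. -/
def copyEdge (v : C → Fin 9 → V) (p : C × Finset (Fin 9)) : Finset V := p.2.image (v p.1)

/-- Pairs covered by an edge of one copy are not claimed by another copy. -/
def Separated (v : C → Fin 9 → V) : Prop :=
  ∀ c c' i j i' j', Shadow i j → Claim i' j' → v c i = v c' i' → v c j = v c' j' → c = c'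

/-- No four edges of copies form a Pasch configuration. -/
def PaschFree (v : C → Fin 9 → V) : Prop :=
  ∀ c₁ c₂ c₃ c₄ a₁ a₂ b₁ b₃ k₁ k₄ d₂ d₃ e₂ e₄ f₃ f₄, Tri a₁ b₁ k₁ → Tri a₂ d₂ e₂ →
    Tri b₃ d₃ f₃ → Tri k₄ e₄ f₄ → v c₁ a₁ = v c₂ a₂ → v c₁ b₁ = v c₃ b₃ → v c₁ k₁ = v c₄ k₄ →
    v c₂ d₂ = v c₃ d₃ → v c₂ e₂ = v c₄ e₄ → v c₃ f₃ = v c₄ f₄ →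
    [v c₁ a₁, v c₁ b₁, v c₁ k₁, v c₂ d₂, v c₂ e₂, v c₃ f₃].Nodup → False

lemma card_copyEdge (hv : ∀ c, Function.Injective (v c)) {p : C × Finset (Fin 9)}
    (hp : p.2 ∈ gadget) : (copyEdge v p).card = 3 := by
  rw [copyEdge, card_image_of_injective _ (hv _), card_of_mem_gadget _ hp]

lemma mem_copyEdge {p : C × Finset (Fin 9)} {x : V} :
    x ∈ copyEdge v p ↔ ∃ i ∈ p.2, v p.1 i = x := by simp [copyEdge]

lemma fst_eq_of_two_le (hs : Separated v) {p q : C × Finset (Fin 9)}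
    (hp : p.2 ∈ gadget) (hq : q.2 ∈ gadget) (h : 2 ≤ (copyEdge v p ∩ copyEdge v q).card) :
    p.1 = q.1 := by
  obtain ⟨x, hx, y, hy, hxy⟩ := one_lt_card.1 h
  simp only [mem_inter, mem_copyEdge] at hx hy
  obtain ⟨⟨i, hi, rfl⟩, i', hi', h1⟩ := hx
  obtain ⟨⟨j, hj, rfl⟩, j', hj', h2⟩ := hy
  refine hs _ _ i j i' j' (shadow_of_mem hp hi hj ?_) (Or.inl (shadow_of_mem hq hi' hj' ?_))
    h1.symm h2.symm
  · rintro rfl; exact hxy rfl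
  · rintro rfl; exact hxy (h1.symm.trans h2)

lemma copyEdge_injOn (hv : ∀ c, Function.Injective (v c)) (hs : Separated v)
    {p q : C × Finset (Fin 9)} (hp : p.2 ∈ gadget) (hq : q.2 ∈ gadget)
    (h : copyEdge v p = copyEdge v q) : p = q := by
  have h1 : p.1 = q.1 := fst_eq_of_two_le hs hp hq (by
    rw [h, inter_self, card_copyEdge hv hq]; omega)
  refine Prod.ext h1 ?_
  unfold copyEdge at h
  rw [h1] at h
  exact image_injective (hv _) h

lemma seven_le_of_three_same (hv : ∀ c, Function.Injective (v c)) (hs : Separated v)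
    {p₁ p₂ p₃ p₄ : C × Finset (Fin 9)} (h₁ : p₁.2 ∈ gadget) (h₂ : p₂.2 ∈ gadget)
    (h₃ : p₃.2 ∈ gadget) (h₄ : p₄.2 ∈ gadget) (n₁₂ : p₁ ≠ p₂) (n₁₃ : p₁ ≠ p₃) (n₁₄ : p₁ ≠ p₄)
    (n₂₃ : p₂ ≠ p₃) (n₂₄ : p₂ ≠ p₄) (n₃₄ : p₃ ≠ p₄) (e₂ : p₁.1 = p₂.1) (e₃ : p₁.1 = p₃.1) :
    7 ≤ (copyEdge v p₁ ∪ copyEdge v p₂ ∪ copyEdge v p₃ ∪ copyEdge v p₄).card := by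
  obtain ⟨c, d₁⟩ := p₁
  obtain ⟨c₂, d₂⟩ := p₂
  obtain ⟨c₃, d₃⟩ := p₃
  obtain ⟨c₄, d₄⟩ := p₄
  dsimp only at *
  subst e₂ e₃
  have m₁₂ : d₁ ≠ d₂ := fun h => n₁₂ (by rw [h])
  have m₁₃ : d₁ ≠ d₃ := fun h => n₁₃ (by rw [h])
  have m₂₃ : d₂ ≠ d₃ := fun h => n₂₃ (by rw [h])
  by_cases hc : c = c₄
  · subst hc
    have m₁₄ : d₁ ≠ d₄ := fun h => n₁₄ (by rw [h])
    have m₂₄ : d₂ ≠ d₄ := fun h => n₂₄ (by rw [h])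
    have m₃₄ : d₃ ≠ d₄ := fun h => n₃₄ (by rw [h])
    have := seven_le_card_sup_four (S := {d₁, d₂, d₃, d₄}) (by
      intro x hx; simp only [mem_insert, mem_singleton] at hx
      rcases hx with rfl | rfl | rfl | rfl <;> assumption) (by
      rw [card_insert_of_notMem, card_eq_three.2 ⟨_, _, _, m₂₃, m₂₄, m₃₄, rfl⟩]
      simp [*])
    simp only [copyEdge, ← image_union]
    rw [card_image_of_injective _ (hv _)]
    simpa [sup_insert, union_assoc] using this
  · set U := d₁ ∪ d₂ ∪ d₃ with hU
    set W := U.filter (fun i => v c i ∈ copyEdge v (c₄, d₄)) with hW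
    have hsup : ({d₁, d₂, d₃} : Finset (Finset (Fin 9))).sup id = U := by
      simp [sup_insert, hU, union_assoc]
    have key := seven_le_card_sup_three (S := {d₁, d₂, d₃}) (by
      intro x hx; simp only [mem_insert, mem_singleton] at hx
      rcases hx with rfl | rfl | rfl <;> assumption)
      (card_eq_three.2 ⟨_, _, _, m₁₂, m₁₃, m₂₃, rfl⟩) (W := W)
      (by rw [hsup]; exact filter_subset _ _) (by
        intro i hi j hj hij hcl
        simp only [hW, mem_filter, mem_copyEdge] at hi hj
        obtain ⟨-, i', hi', h1⟩ := hi
        obtain ⟨-, j', hj', h2⟩ := hj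
        refine hc (hs c₄ c i' j' i j (shadow_of_mem h₄ hi' hj' ?_) hcl h1 h2).symm
        rintro rfl
        exact hij (hv c (h1.symm.trans h2)))
    rw [hsup] at key
    have e1 : copyEdge v (c, d₁) ∪ copyEdge v (c, d₂) ∪ copyEdge v (c, d₃) = U.image (v c) := by
      simp only [copyEdge, hU, image_union]
    rw [e1]
    have h5 := card_union_add_card_inter (U.image (v c)) (copyEdge v (c₄, d₄))
    have h6 : U.image (v c) ∩ copyEdge v (c₄, d₄) = W.image (v c) := by
      ext x; simp only [hW, mem_inter, mem_image, mem_filter]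
      constructor
      · rintro ⟨⟨i, hi, rfl⟩, h⟩; exact ⟨i, ⟨hi, h⟩, rfl⟩
      · rintro ⟨i, ⟨hi, h⟩, rfl⟩; exact ⟨⟨i, hi, rfl⟩, h⟩
    rw [h6, card_image_of_injective _ (hv _), card_image_of_injective _ (hv _),
      card_copyEdge hv h₄] at h5
    have h7 : U.card ≤ (U.image (v c) ∪ copyEdge v (c₄, d₄)).card := by
      rw [← card_image_of_injective U (hv c)]
      exact card_le_card subset_union_left
    omega

lemma seven_le_of_two_share (hv : ∀ c, Function.Injective (v c)) (hs : Separated v)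
    {p₁ p₂ p₃ p₄ : C × Finset (Fin 9)} (h₁ : p₁.2 ∈ gadget) (h₂ : p₂.2 ∈ gadget)
    (h₃ : p₃.2 ∈ gadget) (h₄ : p₄.2 ∈ gadget) (n₁₂ : p₁ ≠ p₂) (n₃₄ : p₃ ≠ p₄)
    (e₃ : p₁.1 ≠ p₃.1) (e₄ : p₁.1 ≠ p₄.1)
    (h : 2 ≤ (copyEdge v p₁ ∩ copyEdge v p₂).card) :
    7 ≤ (copyEdge v p₁ ∪ copyEdge v p₂ ∪ copyEdge v p₃ ∪ copyEdge v p₄).card := by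
  have e₂ := fst_eq_of_two_le hs h₁ h₂ h
  have c₁ := card_copyEdge hv h₁
  have c₂ := card_copyEdge hv h₂
  have c₃ := card_copyEdge hv h₃
  have c₄ := card_copyEdge hv h₄
  -- pairs of points in the union of two edges of a copy sharing two points
  have shadow_union : ∀ {p q : C × Finset (Fin 9)}, p.2 ∈ gadget → q.2 ∈ gadget → p ≠ q →
      2 ≤ (copyEdge v p ∩ copyEdge v q).card →
      (copyEdge v p ∩ copyEdge v q).card = 2 ∧
      ∀ x ∈ copyEdge v p ∪ copyEdge v q, ∀ y ∈ copyEdge v p ∪ copyEdge v q, x ≠ y →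
        ∃ i j, Shadow i j ∧ v p.1 i = x ∧ v p.1 j = y := by
    intro p q hp hq hpq h2
    have e := fst_eq_of_two_le hs hp hq h2
    obtain ⟨c, d⟩ := p
    obtain ⟨c', d'⟩ := q
    dsimp only at e hp hq
    subst e
    simp only [copyEdge] at h2 ⊢
    rw [← image_inter _ _ (hv c), card_image_of_injective _ (hv c)] at h2 ⊢
    obtain ⟨g1, g2⟩ := inter_of_mem_gadget d hp d' hq (fun h => hpq (by rw [h])) h2
    refine ⟨g1, ?_⟩
    rw [← image_union]
    intro x hx y hy hxy
    obtain ⟨i, hi, rfl⟩ := mem_image.1 hx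
    obtain ⟨j, hj, rfl⟩ := mem_image.1 hy
    exact ⟨i, j, g2 i hi j hj (fun h => hxy (by rw [h])), rfl, rfl⟩
  obtain ⟨hc, hsh⟩ := shadow_union h₁ h₂ n₁₂ h
  set A := copyEdge v p₁ ∪ copyEdge v p₂ with hA
  have hAc : A.card = 4 := by
    have := card_union_add_card_inter (copyEdge v p₁) (copyEdge v p₂)
    rw [← hA] at this
    omega
  have small : ∀ {p : C × Finset (Fin 9)}, p.2 ∈ gadget → p₁.1 ≠ p.1 →
      (copyEdge v p ∩ A).card ≤ 1 := by
    intro p hp hne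
    by_contra! hlt
    obtain ⟨x, hx, y, hy, hxy⟩ := one_lt_card.1 hlt
    rw [mem_inter] at hx hy
    obtain ⟨i, j, hij, rfl, rfl⟩ := hsh x hx.2 y hy.2 hxy
    obtain ⟨i', hi', h1⟩ := mem_copyEdge.1 hx.1
    obtain ⟨j', hj', h2⟩ := mem_copyEdge.1 hy.1
    refine hne (hs _ _ i j i' j' hij (Or.inl (shadow_of_mem hp hi' hj' ?_)) h1.symm h2.symm)
    rintro rfl; exact hxy (h1.symm.trans h2)
  have s₃ := small h₃ e₃
  have s₄ := small h₄ e₄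
  by_contra! hlt
  have a₃ := card_sdiff_add_card_inter (copyEdge v p₃) A
  have a₄ := card_sdiff_add_card_inter (copyEdge v p₄) A
  have hU : (A ∪ copyEdge v p₃ ∪ copyEdge v p₄).card =
      A.card + (copyEdge v p₃ \ A ∪ copyEdge v p₄ \ A).card := by
    rw [← card_union_of_disjoint]
    · congr 1; grind
    · rw [disjoint_left]; grind
  have h10 := card_union_add_card_inter (copyEdge v p₃ \ A) (copyEdge v p₄ \ A)
  have h11 : 2 ≤ (copyEdge v p₃ ∩ copyEdge v p₄).card := by
    refine le_trans ?_ (card_le_card (s := (copyEdge v p₃ \ A) ∩ (copyEdge v p₄ \ A)) ?_)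
    · omega
    · exact inter_subset_inter sdiff_subset sdiff_subset
  obtain ⟨hc', hsh'⟩ := shadow_union h₃ h₄ n₃₄ h11
  have h12 := card_union_add_card_inter (copyEdge v p₃) (copyEdge v p₄)
  have h13 := card_sdiff_add_card_inter (copyEdge v p₃ ∪ copyEdge v p₄) A
  rw [union_sdiff_distrib] at h13
  have h14 : 1 < ((copyEdge v p₃ ∪ copyEdge v p₄) ∩ A).card := by omega
  obtain ⟨x, hx, y, hy, hxy⟩ := one_lt_card.1 h14
  rw [mem_inter] at hx hy
  obtain ⟨i, j, hij, h1, h2⟩ := hsh x hx.2 y hy.2 hxy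
  obtain ⟨i', j', hij', h1', h2'⟩ := hsh' x hx.1 y hy.1 hxy
  exact e₃ (hs _ _ i j i' j' hij (Or.inl hij') (h1.trans h1'.symm) (h2.trans h2'.symm))

lemma seven_le_card_union (hv : ∀ c, Function.Injective (v c)) (hs : Separated v)
    (hP : PaschFree v) {p₁ p₂ p₃ p₄ : C × Finset (Fin 9)} (h₁ : p₁.2 ∈ gadget)
    (h₂ : p₂.2 ∈ gadget) (h₃ : p₃.2 ∈ gadget) (h₄ : p₄.2 ∈ gadget) (n₁₂ : p₁ ≠ p₂)
    (n₁₃ : p₁ ≠ p₃) (n₁₄ : p₁ ≠ p₄) (n₂₃ : p₂ ≠ p₃) (n₂₄ : p₂ ≠ p₄) (n₃₄ : p₃ ≠ p₄) :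
    7 ≤ (copyEdge v p₁ ∪ copyEdge v p₂ ∪ copyEdge v p₃ ∪ copyEdge v p₄).card := by
  by_cases t₁₂₃ : p₁.1 = p₂.1 ∧ p₁.1 = p₃.1
  · exact seven_le_of_three_same hv hs h₁ h₂ h₃ h₄ n₁₂ n₁₃ n₁₄ n₂₃ n₂₄ n₃₄ t₁₂₃.1 t₁₂₃.2
  by_cases t₁₂₄ : p₁.1 = p₂.1 ∧ p₁.1 = p₄.1
  · refine (seven_le_of_three_same hv hs h₁ h₂ h₄ h₃ n₁₂ n₁₄ n₁₃ n₂₄ n₂₃ n₃₄.symm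
      t₁₂₄.1 t₁₂₄.2).trans_eq (congrArg card (by grind))
  by_cases t₁₃₄ : p₁.1 = p₃.1 ∧ p₁.1 = p₄.1
  · refine (seven_le_of_three_same hv hs h₁ h₃ h₄ h₂ n₁₃ n₁₄ n₁₂ n₃₄ n₂₃.symm n₂₄.symm
      t₁₃₄.1 t₁₃₄.2).trans_eq (congrArg card (by grind))
  by_cases t₂₃₄ : p₂.1 = p₃.1 ∧ p₂.1 = p₄.1
  · refine (seven_le_of_three_same hv hs h₂ h₃ h₄ h₁ n₂₃ n₂₄ n₁₂.symm n₃₄ n₁₃.symm n₁₄.symm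
      t₂₃₄.1 t₂₃₄.2).trans_eq (congrArg card (by grind))
  have F := @fst_eq_of_two_le V C _ v hs
  by_cases s₁₂ : 2 ≤ (copyEdge v p₁ ∩ copyEdge v p₂).card
  · have := F h₁ h₂ s₁₂
    exact seven_le_of_two_share hv hs h₁ h₂ h₃ h₄ n₁₂ n₃₄ (by grind) (by grind) s₁₂
  by_cases s₁₃ : 2 ≤ (copyEdge v p₁ ∩ copyEdge v p₃).card
  · have := F h₁ h₃ s₁₃
    exact (seven_le_of_two_share hv hs h₁ h₃ h₂ h₄ n₁₃ n₂₄ (by grind) (by grind) s₁₃).trans_eq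
      (congrArg card (by grind))
  by_cases s₁₄ : 2 ≤ (copyEdge v p₁ ∩ copyEdge v p₄).card
  · have := F h₁ h₄ s₁₄
    exact (seven_le_of_two_share hv hs h₁ h₄ h₂ h₃ n₁₄ n₂₃ (by grind) (by grind) s₁₄).trans_eq
      (congrArg card (by grind))
  by_cases s₂₃ : 2 ≤ (copyEdge v p₂ ∩ copyEdge v p₃).card
  · have := F h₂ h₃ s₂₃
    exact (seven_le_of_two_share hv hs h₂ h₃ h₁ h₄ n₂₃ n₁₄ (by grind) (by grind) s₂₃).trans_eq
      (congrArg card (by grind))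
  by_cases s₂₄ : 2 ≤ (copyEdge v p₂ ∩ copyEdge v p₄).card
  · have := F h₂ h₄ s₂₄
    exact (seven_le_of_two_share hv hs h₂ h₄ h₁ h₃ n₂₄ n₁₃ (by grind) (by grind) s₂₄).trans_eq
      (congrArg card (by grind))
  by_cases s₃₄ : 2 ≤ (copyEdge v p₃ ∩ copyEdge v p₄).card
  · have := F h₃ h₄ s₃₄
    exact (seven_le_of_two_share hv hs h₃ h₄ h₁ h₂ n₃₄ n₁₂ (by grind) (by grind) s₃₄).trans_eq
      (congrArg card (by grind))
  by_contra! hlt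
  obtain ⟨a, b, k, d, e, f, hnd, E₁, E₂, E₃, E₄⟩ := exists_pasch (card_copyEdge hv h₁)
    (card_copyEdge hv h₂) (card_copyEdge hv h₃) (card_copyEdge hv h₄) (by omega) (by omega)
    (by omega) (by omega) (by omega) (by omega) (by omega : _ ≤ 6)
  have pos : ∀ {p : C × Finset (Fin 9)} {x y z : V}, p.2 ∈ gadget → copyEdge v p = {x, y, z} →
      ∃ i j l, Tri i j l ∧ v p.1 i = x ∧ v p.1 j = y ∧ v p.1 l = z := by
    intro p x y z hp h
    obtain ⟨i, hi, rfl⟩ := mem_copyEdge.1 (by rw [h]; simp : x ∈ copyEdge v p)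
    obtain ⟨j, hj, rfl⟩ := mem_copyEdge.1 (by rw [h]; simp : y ∈ copyEdge v p)
    obtain ⟨l, hl, rfl⟩ := mem_copyEdge.1 (by rw [h]; simp : z ∈ copyEdge v p)
    refine ⟨i, j, l, ?_, rfl, rfl, rfl⟩
    have : p.2 = {i, j, l} := image_injective (hv p.1) (by
      rw [copyEdge] at h
      rw [h]
      simp [image_insert])
    rwa [Tri, ← this]
  obtain ⟨a₁, b₁, k₁, T₁, rfl, rfl, rfl⟩ := pos h₁ E₁
  obtain ⟨a₂, d₂, e₂, T₂, ha, rfl, rfl⟩ := pos h₂ E₂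
  obtain ⟨b₃, d₃, f₃, T₃, hb, hd, rfl⟩ := pos h₃ E₃
  obtain ⟨k₄, e₄, f₄, T₄, hk, he, hf⟩ := pos h₄ E₄
  exact hP p₁.1 p₂.1 p₃.1 p₄.1 a₁ a₂ b₁ b₃ k₁ k₄ d₂ d₃ e₂ e₄ f₃ f₄ T₁ T₂ T₃ T₄ ha.symm hb.symm
    hk.symm hd.symm he.symm hf.symm hnd

/-- All edges of all copies. -/
def copyFamily [Fintype C] (v : C → Fin 9 → V) : Finset (Finset V) :=
  (univ ×ˢ gadget).image (copyEdge v)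

lemma card_copyFamily [Fintype C] (hv : ∀ c, Function.Injective (v c)) (hs : Separated v) :
    (copyFamily v).card = 7 * Fintype.card C := by
  rw [copyFamily, card_image_of_injOn, card_product, card_gadget, card_univ, mul_comm]
  intro p hp q hq h
  simp only [coe_product, Set.mem_prod, mem_coe] at hp hq
  exact copyEdge_injOn hv hs hp.2 hq.2 h

lemma card_of_mem_copyFamily [Fintype C] (hv : ∀ c, Function.Injective (v c)) :
    ∀ e ∈ copyFamily v, e.card = 3 := by
  intro e he
  obtain ⟨p, hp, rfl⟩ := mem_image.1 he
  exact card_copyEdge hv (mem_product.1 hp).2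

lemma isFree_copyFamily [Fintype C] (hv : ∀ c, Function.Injective (v c)) (hs : Separated v)
    (hP : PaschFree v) : IsFree (copyFamily v) 6 4 := by
  rintro ⟨S, hS, hc, h6⟩
  obtain ⟨E, S', hE, rfl, hc'⟩ := card_eq_succ.1 hc
  obtain ⟨E₂, E₃, E₄, n₂₃, n₂₄, n₃₄, rfl⟩ := card_eq_three.1 hc'
  have hm : ∀ X ∈ ({E, E₂, E₃, E₄} : Finset (Finset V)), ∃ p : C × Finset (Fin 9),
      p.2 ∈ gadget ∧ copyEdge v p = X := by
    intro X hX
    obtain ⟨p, hp, h⟩ := mem_image.1 (hS hX)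
    exact ⟨p, (mem_product.1 hp).2, h⟩
  obtain ⟨p₁, h₁, rfl⟩ := hm E (by simp)
  obtain ⟨p₂, h₂, rfl⟩ := hm E₂ (by simp)
  obtain ⟨p₃, h₃, rfl⟩ := hm E₃ (by simp)
  obtain ⟨p₄, h₄, rfl⟩ := hm E₄ (by simp)
  simp only [mem_insert, mem_singleton, not_or] at hE
  have key := seven_le_card_union hv hs hP h₁ h₂ h₃ h₄ (fun h => hE.1 (by rw [h]))
    (fun h => hE.2.1 (by rw [h])) (fun h => hE.2.2 (by rw [h])) (fun h => n₂₃ (by rw [h]))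
    (fun h => n₂₄ (by rw [h])) (fun h => n₃₄ (by rw [h]))
  simp only [sup_insert, sup_singleton, id, sup_eq_union, ← union_assoc] at h6
  omega

end Copies

/-- The expression deciding whether two copies can use a pair of positions crosswise. -/
def cross {S : Type*} [CommRing S] (z w : Fin 9 → S) (a b c a' b' c' : Fin 9) : S :=
  (z b - z a) * (w c' - w a') + (z c - z a) * (w b' - w a')

lemma Tri.ne {i j k : Fin 9} (h : Tri i j k) : i ≠ j ∧ i ≠ k ∧ j ≠ k :=
  ⟨h.shadow.1.ne, h.shadow.2.1.ne, h.shadow.2.2.ne⟩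

lemma card_four {α : Type*} [DecidableEq α] {a b c d : α} (hab : a ≠ b) (hac : a ≠ c)
    (had : a ≠ d) (hbc : b ≠ c) (hbd : b ≠ d) (hcd : c ≠ d) : ({a, b, c, d} : Finset α).card = 4 := by
  rw [card_insert_of_notMem, card_eq_three.2 ⟨_, _, _, hbc, hbd, hcd, rfl⟩]
  simp only [mem_insert, mem_singleton, not_or]
  exact ⟨hab, hac, had⟩

lemma card_sup_pasch {α : Type*} [DecidableEq α] (a b c d e f : α) :
    (({{a, b, c}, {a, d, e}, {b, d, f}, {c, e, f}} : Finset (Finset α)).sup id).card ≤ 6 := by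
  refine (card_le_card (t := {a, b, c, d, e, f}) fun x => ?_).trans card_le_six
  simp only [sup_insert, sup_singleton, id, sup_eq_union, mem_union, mem_insert, mem_singleton]
  tauto

lemma triple_eq {α : Type*} [DecidableEq α] {x y z x' y' z' : α}
    (h : ({x, y, z} : Finset α) = {x', y', z'}) :
    (x' = x ∨ x' = y ∨ x' = z) ∧ (y' = x ∨ y' = y ∨ y' = z) ∧ (z' = x ∨ z' = y ∨ z' = z) := by
  have := Finset.ext_iff.1 h
  exact ⟨by simpa using (this x').2 (by simp), by simpa using (this y').2 (by simp),
    by simpa using (this z').2 (by simp)⟩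

lemma Tri.eq_of_pasch {a b c d e f : Fin 9} (h₁ : Tri a b c) (h₂ : Tri a d e) (h₃ : Tri b d f)
    (h₄ : Tri c e f) : (d = c ∧ e = b) ∨ (a = f ∧ d = c) ∨ (e = b ∧ a = f) := by
  have n₁ := h₁.ne
  have n₂ := h₂.ne
  have n₃ := h₃.ne
  have n₄ := h₄.ne
  by_contra! hcon
  have m₁₂ : ({a, b, c} : Finset (Fin 9)) ≠ {a, d, e} := fun h => by have := triple_eq h; grind
  have m₁₃ : ({a, b, c} : Finset (Fin 9)) ≠ {b, d, f} := fun h => by have := triple_eq h; grind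
  have m₁₄ : ({a, b, c} : Finset (Fin 9)) ≠ {c, e, f} := fun h => by have := triple_eq h; grind
  have m₂₃ : ({a, d, e} : Finset (Fin 9)) ≠ {b, d, f} := fun h => by have := triple_eq h; grind
  have m₂₄ : ({a, d, e} : Finset (Fin 9)) ≠ {c, e, f} := fun h => by have := triple_eq h; grind
  have m₃₄ : ({b, d, f} : Finset (Fin 9)) ≠ {c, e, f} := fun h => by have := triple_eq h; grind
  have h7 := seven_le_card_sup_four (S := {{a, b, c}, {a, d, e}, {b, d, f}, {c, e, f}}) (by
    intro x hx
    simp only [mem_insert, mem_singleton] at hx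
    rcases hx with rfl | rfl | rfl | rfl <;> assumption) (card_four m₁₂ m₁₃ m₁₄ m₂₃ m₂₄ m₃₄)
  exact absurd (h7.trans (card_sup_pasch a b c d e f)) (by norm_num)

/-- The data placing copies of the gadget on the vertex set `X × R`. The copy with parameters
`(β, s, t)` sends position `i` to `(φ β i, s + z β i * t + o β i)`. -/
structure Layout (X B R S : Type*) [CommRing R] [CommRing S] where
  φ : B → Fin 9 → X
  z : B → Fin 9 → R
  o : B → Fin 9 → R
  T : Finset R
  π : R →+* S
  φ_inj : ∀ β, Function.Injective (φ β)
  isUnit_sub : ∀ β i j, Shadow i j → IsUnit (z β i - z β j)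
  isUnit_cross : ∀ β a a' b c, Tri a b c → Tri a' b c → IsUnit (cross (z β) (z β) a b c a' b c)
  isUnit_cross_π : ∀ β β' a b c a' b' c', Tri a b c → Tri a' b' c' →
    IsUnit (π (cross (z β) (z β') a b c a' b' c'))
  π_o : ∀ β i, π (o β i) = 0
  colour : ∀ β β' i j i' j', ∀ t ∈ T, ∀ t' ∈ T, Shadow i j → Claim i' j' → φ β i = φ β' i' →
    φ β j = φ β' j' → π (z β i - z β j) * π t = π (z β' i' - z β' j') * π t' → β = β'
  eq_of_three : ∀ β β' i j k i' j' k', φ β i = φ β' i' → φ β j = φ β' j' → φ β k = φ β' k' →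
    i ≠ j → i ≠ k → j ≠ k → β = β'
  eq_of_triangle : ∀ β β₃ β₄ b b₃ d d₃ k k₄ e e₄ f₃ f₄, β ≠ β₃ → β ≠ β₄ → φ β b = φ β₃ b₃ →
    φ β d = φ β₃ d₃ → φ β k = φ β₄ k₄ → φ β e = φ β₄ e₄ → φ β₃ f₃ = φ β₄ f₄ → b₃ ≠ d₃ →
    f₃ ≠ b₃ → f₃ ≠ d₃ → k₄ ≠ e₄ → f₄ ≠ k₄ → f₄ ≠ e₄ → (b = k ∧ d = e) ∨ (b = e ∧ d = k)
  kill : ∀ β₁ β₂ β₃ β₄ a₁ a₂ b₁ b₃ k₁ k₄ d₂ d₃ e₂ e₄ f₃ f₄, [β₁, β₂, β₃, β₄].Nodup →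
    Tri a₁ b₁ k₁ → Tri a₂ d₂ e₂ → Tri b₃ d₃ f₃ → Tri k₄ e₄ f₄ →
    ∀ s₁ t₁ s₂ t₂ s₃ t₃ s₄ t₄ : R,
    s₁ + z β₁ a₁ * t₁ + o β₁ a₁ = s₂ + z β₂ a₂ * t₂ + o β₂ a₂ →
    s₁ + z β₁ b₁ * t₁ + o β₁ b₁ = s₃ + z β₃ b₃ * t₃ + o β₃ b₃ →
    s₁ + z β₁ k₁ * t₁ + o β₁ k₁ = s₄ + z β₄ k₄ * t₄ + o β₄ k₄ →
    s₂ + z β₂ d₂ * t₂ + o β₂ d₂ = s₃ + z β₃ d₃ * t₃ + o β₃ d₃ →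
    s₂ + z β₂ e₂ * t₂ + o β₂ e₂ = s₄ + z β₄ e₄ * t₄ + o β₄ e₄ →
    s₃ + z β₃ f₃ * t₃ + o β₃ f₃ = s₄ + z β₄ f₄ * t₄ + o β₄ f₄ → False

namespace Layout

variable {X B R S : Type*} [CommRing R] [CommRing S] (L : Layout X B R S)

/-- The position of the vertices of a copy. -/
def vert (c : B × R × L.T) (i : Fin 9) : X × R :=
  (L.φ c.1 i, c.2.1 + L.z c.1 i * c.2.2 + L.o c.1 i)

lemma vert_inj (c : B × R × L.T) : Function.Injective (L.vert c) := fun _ _ h =>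
  L.φ_inj c.1 (Prod.ext_iff.1 h).1

variable {L}

lemma π_sub {c c' : B × R × L.T} {i j i' j' : Fin 9} (hi : (L.vert c i).2 = (L.vert c' i').2)
    (hj : (L.vert c j).2 = (L.vert c' j').2) :
    L.π (L.z c.1 i - L.z c.1 j) * L.π c.2.2 = L.π (L.z c'.1 i' - L.z c'.1 j') * L.π c'.2.2 := by
  have h1 := congrArg L.π hi
  have h2 := congrArg L.π hj
  simp only [vert, map_add, map_mul, π_o] at h1 h2
  simp only [map_sub]
  linear_combination h1 - h2

variable (L)

lemma separated : Separated L.vert := by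
  rintro ⟨β, s, t⟩ ⟨β', s', t'⟩ i j i' j' hsh hcl hi hj
  have hβ : β = β' := L.colour β β' i j i' j' t t.2 t' t'.2 hsh hcl (Prod.ext_iff.1 hi).1
    (Prod.ext_iff.1 hj).1 (π_sub (Prod.ext_iff.1 hi).2 (Prod.ext_iff.1 hj).2)
  subst hβ
  obtain rfl : i = i' := L.φ_inj β (Prod.ext_iff.1 hi).1
  obtain rfl : j = j' := L.φ_inj β (Prod.ext_iff.1 hj).1
  have h1 := (Prod.ext_iff.1 hi).2
  have h2 := (Prod.ext_iff.1 hj).2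
  simp only [vert] at h1 h2
  have ht : (t : R) = t' := by
    refine (L.isUnit_sub β i j hsh).mul_left_cancel ?_
    linear_combination h1 - h2
  have hs : s = s' := by
    rw [ht] at h1
    linear_combination h1
  rw [hs, Subtype.ext ht]

/-- Four copies whose edges at the given positions form a Pasch configuration. -/
structure IsPasch (c₁ c₂ c₃ c₄ : B × R × L.T)
    (a₁ a₂ b₁ b₃ k₁ k₄ d₂ d₃ e₂ e₄ f₃ f₄ : Fin 9) : Prop where
  t₁ : Tri a₁ b₁ k₁
  t₂ : Tri a₂ d₂ e₂
  t₃ : Tri b₃ d₃ f₃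
  t₄ : Tri k₄ e₄ f₄
  ha : L.vert c₁ a₁ = L.vert c₂ a₂
  hb : L.vert c₁ b₁ = L.vert c₃ b₃
  hk : L.vert c₁ k₁ = L.vert c₄ k₄
  hd : L.vert c₂ d₂ = L.vert c₃ d₃
  he : L.vert c₂ e₂ = L.vert c₄ e₄
  hf : L.vert c₃ f₃ = L.vert c₄ f₄
  be : L.vert c₁ b₁ ≠ L.vert c₂ e₂
  kd : L.vert c₁ k₁ ≠ L.vert c₂ d₂
  af : L.vert c₁ a₁ ≠ L.vert c₃ f₃

namespace IsPasch

variable {L} {c₁ c₂ c₃ c₄ : B × R × L.T} {a₁ a₂ b₁ b₃ k₁ k₄ d₂ d₃ e₂ e₄ f₃ f₄ : Fin 9}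

lemma swap₁₂ (h : L.IsPasch c₁ c₂ c₃ c₄ a₁ a₂ b₁ b₃ k₁ k₄ d₂ d₃ e₂ e₄ f₃ f₄) :
    L.IsPasch c₂ c₁ c₃ c₄ a₂ a₁ d₂ d₃ e₂ e₄ b₁ b₃ k₁ k₄ f₃ f₄ :=
  ⟨h.t₂, h.t₁, h.t₃.swap.rotate.rotate, h.t₄.swap.rotate.rotate,
    h.ha.symm, h.hd, h.he, h.hb, h.hk, h.hf, h.kd.symm, h.be.symm, h.ha ▸ h.af⟩

lemma swap₂₃ (h : L.IsPasch c₁ c₂ c₃ c₄ a₁ a₂ b₁ b₃ k₁ k₄ d₂ d₃ e₂ e₄ f₃ f₄) :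
    L.IsPasch c₁ c₃ c₂ c₄ b₁ b₃ a₁ a₂ k₁ k₄ d₃ d₂ f₃ f₄ e₂ e₄ :=
  ⟨h.t₁.swap.rotate.rotate, h.t₃, h.t₂, h.t₄.swap, h.hb, h.ha, h.hk, h.hd.symm, h.hf, h.he,
    h.af, h.hd ▸ h.kd, h.be⟩

lemma swap₃₄ (h : L.IsPasch c₁ c₂ c₃ c₄ a₁ a₂ b₁ b₃ k₁ k₄ d₂ d₃ e₂ e₄ f₃ f₄) :
    L.IsPasch c₁ c₂ c₄ c₃ a₁ a₂ k₁ k₄ b₁ b₃ e₂ e₄ d₂ d₃ f₄ f₃ :=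
  ⟨h.t₁.swap, h.t₂.swap, h.t₄, h.t₃, h.ha, h.hk, h.hb, h.he, h.hd, h.hf.symm, h.kd, h.be,
    h.hf ▸ h.af⟩

lemma not_same_base {c₁ c₂ c₃ c₄ : B × R × L.T} {a b k b₃ k₄ d₃ e₄ f₃ f₄ : Fin 9}
    (h : L.IsPasch c₁ c₂ c₃ c₄ a a b b₃ k k₄ k d₃ b e₄ f₃ f₄) (hβ : c₁.1 = c₂.1) : False := by
  obtain ⟨β, s₁, t₁⟩ := c₁
  obtain ⟨β₂, s₂, t₂⟩ := c₂
  obtain ⟨β₃, s₃, t₃⟩ := c₃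
  obtain ⟨β₄, s₄, t₄⟩ := c₄
  obtain rfl : β = β₂ := hβ
  obtain ⟨T₁, T₂, T₃, T₄, ha, hb, hk, hd, he, hf, be, kd, af⟩ := h
  simp only [vert, Prod.mk.injEq] at ha hb hk hd he hf
  obtain rfl : β₃ = β₄ := L.eq_of_three β₃ β₄ b₃ d₃ f₃ e₄ k₄ f₄ (hb.1.symm.trans he.1)
    (hd.1.symm.trans hk.1) hf.1 T₃.ne.1 T₃.ne.2.1 T₃.ne.2.2
  obtain rfl : b₃ = e₄ := L.φ_inj β₃ (hb.1.symm.trans he.1)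
  obtain rfl : d₃ = k₄ := L.φ_inj β₃ (hd.1.symm.trans hk.1)
  obtain rfl : f₃ = f₄ := L.φ_inj β₃ hf.1
  -- the parameter differences of the two pairs of copies
  set δ : R := t₁ - t₂
  have key : cross (L.z β) (L.z β₃) a b k f₃ b₃ d₃ * δ = 0 := by
    have e1 : (L.z β b - L.z β a) * (t₁ - t₂ : R) = (L.z β₃ b₃ - L.z β₃ f₃) * (t₃ - t₄ : R) := by
      linear_combination hb.2 - he.2 - ha.2 + hf.2
    have e2 : (L.z β k - L.z β a) * (t₁ - t₂ : R) = -(L.z β₃ d₃ - L.z β₃ f₃) * (t₃ - t₄ : R) := by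
      linear_combination hk.2 - hd.2 - ha.2 - hf.2
    simp only [cross, δ]
    linear_combination (L.z β₃ d₃ - L.z β₃ f₃) * e1 + (L.z β₃ b₃ - L.z β₃ f₃) * e2
  by_cases hββ : β = β₃
  · subst hββ
    obtain rfl : b = b₃ := L.φ_inj β hb.1
    obtain rfl : k = d₃ := L.φ_inj β hd.1
    have hδ : δ = 0 :=
      (L.isUnit_cross β a f₃ b k T₁ T₃.rotate.rotate).mul_right_eq_zero.1 key
    refine be (Prod.ext rfl ?_)
    have : (t₁ : R) = t₂ := sub_eq_zero.1 hδ
    simp only [vert]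
    rw [this] at ha ⊢
    linear_combination ha.2
  · have hδ : L.π δ = 0 := by
      refine (L.isUnit_cross_π β β₃ a b k f₃ b₃ d₃ T₁ T₃.rotate.rotate).mul_right_eq_zero.1 ?_
      rw [← map_mul, key, map_zero]
    refine hββ (L.colour β β₃ b k b₃ d₃ t₁ t₁.2 t₄ t₄.2 T₁.shadow.2.2 (Or.inl T₃.shadow.1)
      hb.1 hd.1 ?_)
    have ht : L.π t₁ = L.π t₂ := by rw [← sub_eq_zero, ← map_sub]; exact hδ
    have pa := congrArg L.π ha.2
    have pk := congrArg L.π hk.2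
    have pe := congrArg L.π he.2
    simp only [map_add, map_mul, π_o] at pa pk pe
    rw [← ht] at pa pe
    simp only [map_sub]
    linear_combination pe - pk + pa

lemma not_same_block (h : L.IsPasch c₁ c₂ c₃ c₄ a₁ a₂ b₁ b₃ k₁ k₄ d₂ d₃ e₂ e₄ f₃ f₄)
    (hβ : c₁.1 = c₂.1) : False := by
  have φi := L.φ_inj
  have ha := (Prod.ext_iff.1 h.ha).1
  have hb := (Prod.ext_iff.1 h.hb).1
  have hk := (Prod.ext_iff.1 h.hk).1
  have hd := (Prod.ext_iff.1 h.hd).1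
  have he := (Prod.ext_iff.1 h.he).1
  have hf := (Prod.ext_iff.1 h.hf).1
  simp only [vert] at ha hb hk hd he hf
  rw [← hβ] at ha hd he
  obtain rfl : a₁ = a₂ := φi _ ha
  have base : ¬ (d₂ = k₁ ∧ e₂ = b₁) := by
    rintro ⟨rfl, rfl⟩
    exact h.not_same_base hβ
  have n₁ := h.t₁.ne
  have n₂ := h.t₂.ne
  have n₃ := h.t₃.ne
  have n₄ := h.t₄.ne
  have h34 : c₁.1 = c₃.1 ↔ c₁.1 = c₄.1 := by
    constructor
    · intro h3
      rw [← h3] at hb hd hf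
      have i1 := φi _ hb
      have i2 := φi _ hd
      refine L.eq_of_three c₁.1 c₄.1 k₁ e₂ f₃ k₄ e₄ f₄ hk he hf ?_ ?_ ?_
      · rintro rfl; exact n₄.1 (φi _ (hk.symm.trans he))
      · rintro rfl; exact n₄.2.1 (φi _ (hk.symm.trans hf))
      · rintro rfl; exact n₄.2.2 (φi _ (he.symm.trans hf))
    · intro h4
      rw [← h4] at hk he hf
      refine L.eq_of_three c₁.1 c₃.1 b₁ d₂ f₄ b₃ d₃ f₃ hb hd hf.symm ?_ ?_ ?_
      · rintro rfl; exact n₃.1 (φi _ (hb.symm.trans hd))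
      · rintro rfl; exact n₃.2.1 (φi _ (hb.symm.trans hf.symm))
      · rintro rfl; exact n₃.2.2 (φi _ (hd.symm.trans hf.symm))
  by_cases h3 : c₁.1 = c₃.1
  · have h4 := h34.1 h3
    rw [← h3] at hb hd hf
    rw [← h4] at hk he hf
    obtain rfl := φi _ hb
    obtain rfl := φi _ hd
    obtain rfl := φi _ hk
    obtain rfl := φi _ he
    obtain rfl := φi _ hf
    rcases Tri.eq_of_pasch h.t₁ h.t₂ h.t₃ h.t₄ with h' | h' | h'
    · exact base h'
    · obtain ⟨rfl, rfl⟩ := h'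
      exact h.swap₂₃.not_same_base h3
    · obtain ⟨rfl, rfl⟩ := h'
      exact h.swap₃₄.swap₂₃.not_same_base h4
  · have h4 : c₁.1 ≠ c₄.1 := fun h => h3 (h34.2 h)
    rcases L.eq_of_triangle _ _ _ b₁ b₃ d₂ d₃ k₁ k₄ e₂ e₄ f₃ f₄ h3 h4 hb hd hk he hf n₃.1
      n₃.2.1.symm n₃.2.2.symm n₄.1 n₄.2.1.symm n₄.2.2.symm with h' | h'
    · exact n₁.2.2 h'.1
    · exact base ⟨h'.2, h'.1.symm⟩

protected lemma false (h : L.IsPasch c₁ c₂ c₃ c₄ a₁ a₂ b₁ b₃ k₁ k₄ d₂ d₃ e₂ e₄ f₃ f₄) : False := by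
  have m₁₂ : c₁.1 ≠ c₂.1 := h.not_same_block
  have m₁₃ : c₁.1 ≠ c₃.1 := h.swap₂₃.not_same_block
  have m₁₄ : c₁.1 ≠ c₄.1 := h.swap₃₄.swap₂₃.not_same_block
  have m₂₃ : c₂.1 ≠ c₃.1 := h.swap₁₂.swap₂₃.not_same_block
  have m₂₄ : c₂.1 ≠ c₄.1 := h.swap₁₂.swap₃₄.swap₂₃.not_same_block
  have m₃₄ : c₃.1 ≠ c₄.1 := h.swap₂₃.swap₁₂.swap₃₄.swap₂₃.not_same_block
  exact L.kill c₁.1 c₂.1 c₃.1 c₄.1 a₁ a₂ b₁ b₃ k₁ k₄ d₂ d₃ e₂ e₄ f₃ f₄ (by simp [*]) h.t₁ h.t₂ h.t₃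
    h.t₄ _ _ _ _ _ _ _ _ (Prod.ext_iff.1 h.ha).2 (Prod.ext_iff.1 h.hb).2 (Prod.ext_iff.1 h.hk).2
    (Prod.ext_iff.1 h.hd).2 (Prod.ext_iff.1 h.he).2 (Prod.ext_iff.1 h.hf).2

end IsPasch

lemma paschFree : PaschFree L.vert := by
  intro c₁ c₂ c₃ c₄ a₁ a₂ b₁ b₃ k₁ k₄ d₂ d₃ e₂ e₄ f₃ f₄ t₁ t₂ t₃ t₄ ha hb hk hd he hf hnd
  simp only [List.nodup_cons, List.mem_cons, not_or] at hnd
  exact IsPasch.false (L := L) ⟨t₁, t₂, t₃, t₄, ha, hb, hk, hd, he, hf, by tauto, by tauto, by tauto⟩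

lemma exists_isFree [Fintype X] [Fintype R] [Fintype B] [DecidableEq X] [DecidableEq R] :
    ∃ G : Finset (Finset (X × R)), (∀ e ∈ G, e.card = 3) ∧ IsFree G 6 4 ∧
      G.card = 7 * (Fintype.card B * (Fintype.card R * L.T.card)) :=
  ⟨copyFamily L.vert, card_of_mem_copyFamily L.vert_inj, isFree_copyFamily L.vert_inj L.separated
    L.paschFree, by simp [card_copyFamily L.vert_inj L.separated]⟩

end Layout

/-- Directions of template lines: an offset, a slope, and a colour class. -/
abbrev Idx (K r : ℕ) : Type := ZMod K × Fin (K / 2) × Fin r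

/-- The space of labels attached to the points of the template. -/
abbrev Label (K r : ℕ) : Type := Idx K r × ZMod K → ZMod K

/-- Points of the template. -/
abbrev Point (K r : ℕ) : Type := ZMod K × Label K r

/-- Blocks of the template: a direction together with an affine function. -/
abbrev Block (K r : ℕ) : Type := Idx K r × Label K r × Label K r

namespace Block

variable {K r : ℕ}

/-- The first coordinate of the `i`-th point of a block. -/
def abscissa (β : Block K r) (i : Fin 9) : ZMod K :=
  β.1.1 + ((β.1.2.1 : ℕ) + 1 : ℕ) * ((i : ℕ) : ZMod K)

/-- The `i`-th point of a block. -/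
def point (β : Block K r) (i : Fin 9) : Point K r :=
  (β.abscissa i, fun w =>
    β.2.1 w + β.abscissa i * β.2.2 w + if w = (β.1, β.abscissa i) then 1 else 0)

lemma abscissa_eq {β β' : Block K r} {i i' : Fin 9} (h : β.point i = β'.point i') :
    β.abscissa i = β'.abscissa i' := (Prod.ext_iff.1 h).1

variable [Fact K.Prime]

lemma natCast_inj (hK : 9 ≤ K) {i j : Fin 9} (h : ((i : ℕ) : ZMod K) = (j : ℕ)) : i = j := by
  rw [ZMod.natCast_eq_natCast_iff, Nat.ModEq, Nat.mod_eq_of_lt (by omega),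
    Nat.mod_eq_of_lt (by omega)] at h
  exact Fin.ext h

lemma slope_ne_zero (v : Fin (K / 2)) : (((v : ℕ) + 1 : ℕ) : ZMod K) ≠ 0 := by
  rw [Ne, ZMod.natCast_eq_zero_iff]
  intro h
  have := Nat.le_of_dvd (by omega) h
  have := v.2
  omega

lemma abscissa_inj (hK : 9 ≤ K) (β : Block K r) : Function.Injective β.abscissa := by
  intro i j h
  simp only [abscissa, add_right_inj] at h
  exact natCast_inj hK (mul_left_cancel₀ (slope_ne_zero _) h)

lemma point_inj (hK : 9 ≤ K) (β : Block K r) : Function.Injective β.point := fun _ _ h =>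
  abscissa_inj hK β (Prod.ext_iff.1 h).1

/-- The affine function attached to a pair of blocks and a label coordinate. -/
def diff (β β' : Block K r) (w : Idx K r × ZMod K) (x : ZMod K) : ZMod K :=
  (β.2.1 w - β'.2.1 w) + x * (β.2.2 w - β'.2.2 w)

lemma diff_eq {β β' : Block K r} {i i' : Fin 9} (h : β.point i = β'.point i')
    (w : Idx K r × ZMod K) :
    diff β β' w (β.abscissa i) = (if w = (β'.1, β.abscissa i) then 1 else 0) -
      (if w = (β.1, β.abscissa i) then 1 else 0) := by
  have h1 := congrFun (Prod.ext_iff.1 h).2 w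
  simp only [point, ← abscissa_eq h] at h1
  simp only [diff]
  linear_combination h1

lemma diff_zero {β β' : Block K r} {w : Idx K r × ZMod K} {x y : ZMod K} (hxy : x ≠ y)
    (hx : diff β β' w x = 0) (hy : diff β β' w y = 0) :
    β.2.1 w = β'.2.1 w ∧ β.2.2 w = β'.2.2 w := by
  simp only [diff] at hx hy
  have h1 : (x - y) * (β.2.2 w - β'.2.2 w) = 0 := by linear_combination hx - hy
  have h2 := (mul_eq_zero.1 h1).resolve_left (sub_ne_zero.2 hxy)
  rw [h2, mul_zero, add_zero] at hx
  exact ⟨sub_eq_zero.1 hx, sub_eq_zero.1 h2⟩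

lemma diff_zero_apply {β β' : Block K r} {w : Idx K r × ZMod K} {x y : ZMod K} (hxy : x ≠ y)
    (hx : diff β β' w x = 0) (hy : diff β β' w y = 0) (u : ZMod K) : diff β β' w u = 0 := by
  obtain ⟨h1, h2⟩ := diff_zero hxy hx hy
  simp [diff, h1, h2]

lemma eq_of_idx_eq (hK : 9 ≤ K) {β β' : Block K r} (hidx : β.1 = β'.1) {i j i' j' : Fin 9}
    (hi : β.point i = β'.point i') (hj : β.point j = β'.point j') (hij : i ≠ j) : β = β' := by
  have key : ∀ w, β.2.1 w = β'.2.1 w ∧ β.2.2 w = β'.2.2 w := fun w =>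
    diff_zero (fun h => hij (abscissa_inj hK β h)) (by rw [diff_eq hi, hidx, sub_self])
      (by rw [diff_eq hj, hidx, sub_self])
  exact Prod.ext hidx (Prod.ext (funext fun w => (key w).1) (funext fun w => (key w).2))

lemma eq_of_three (hK : 9 ≤ K) (β β' : Block K r) (i j k i' j' k' : Fin 9)
    (hi : β.point i = β'.point i') (hj : β.point j = β'.point j') (hk : β.point k = β'.point k')
    (hij : i ≠ j) (hik : i ≠ k) (hjk : j ≠ k) : β = β' := by
  by_cases hidx : β.1 = β'.1
  · exact eq_of_idx_eq hK hidx hi hj hij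
  exfalso
  have inj := abscissa_inj hK β
  have h1 := diff_eq hi (β.1, β.abscissa i)
  have h2 := diff_eq hj (β.1, β.abscissa i)
  have h3 := diff_eq hk (β.1, β.abscissa i)
  simp only [Prod.mk.injEq, hidx, inj.eq_iff, hij, hik, and_false, and_true,
    if_true, if_false, sub_zero, zero_sub] at h1 h2 h3
  rw [diff_zero_apply (fun h => hjk (inj h)) h2 h3] at h1
  exact one_ne_zero (neg_eq_zero.1 h1.symm)

lemma mem_of_triangle (hK : 9 ≤ K) {β β₃ β₄ : Block K r} {b b₃ d d₃ k k₄ e e₄ f₃ f₄ : Fin 9}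
    (h₃ : β.1 ≠ β₃.1) (h₄ : β.1 ≠ β₄.1) (hb : β.point b = β₃.point b₃)
    (hd : β.point d = β₃.point d₃) (hk : β.point k = β₄.point k₄) (he : β.point e = β₄.point e₄)
    (hf : β₃.point f₃ = β₄.point f₄) (hbd : b ≠ d) (hfd : f₃ ≠ d₃) (hke : k ≠ e) :
    b = k ∨ b = e := by
  by_contra! hcon
  have inj := abscissa_inj hK β
  have inj₃ := abscissa_inj hK β₃
  have h1 := diff_eq hb (β.1, β.abscissa b)
  have h2 := diff_eq hd (β.1, β.abscissa b)
  have h3 := diff_eq hk (β.1, β.abscissa b)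
  have h4 := diff_eq he (β.1, β.abscissa b)
  have h5 := diff_eq hf (β.1, β.abscissa b)
  simp only [Prod.mk.injEq, h₃, h₄, inj.eq_iff, hbd, hcon.1, hcon.2, false_and, and_false,
    and_true, if_true, if_false, sub_zero, zero_sub] at h1 h2 h3 h4 h5
  have h6 := diff_zero_apply (fun h => hke (inj h)) h3 h4 (β₃.abscissa f₃)
  have h7 : diff β β₃ (β.1, β.abscissa b) (β₃.abscissa f₃) = 0 := by
    simp only [diff] at h5 h6 ⊢
    linear_combination h6 - h5
  have h8 : β₃.abscissa f₃ ≠ β.abscissa d := by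
    rw [abscissa_eq hd]
    exact fun h => hfd (inj₃ h)
  rw [diff_zero_apply h8 h7 h2] at h1
  exact one_ne_zero (neg_eq_zero.1 h1.symm)

lemma eq_of_triangle (hK : 9 ≤ K) (β β₃ β₄ : Block K r) (b b₃ d d₃ k k₄ e e₄ f₃ f₄ : Fin 9)
    (h₃ : β ≠ β₃) (h₄ : β ≠ β₄) (hb : β.point b = β₃.point b₃)
    (hd : β.point d = β₃.point d₃) (hk : β.point k = β₄.point k₄) (he : β.point e = β₄.point e₄)
    (hf : β₃.point f₃ = β₄.point f₄) (hbd : b₃ ≠ d₃) (hfb : f₃ ≠ b₃) (hfd : f₃ ≠ d₃)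
    (hke : k₄ ≠ e₄) (_ : f₄ ≠ k₄) (_ : f₄ ≠ e₄) : (b = k ∧ d = e) ∨ (b = e ∧ d = k) := by
  have hbd' : b ≠ d := fun h => hbd (point_inj hK β₃ (by rw [← hb, ← hd, h]))
  have hke' : k ≠ e := fun h => hke (point_inj hK β₄ (by rw [← hk, ← he, h]))
  have i₃ : β.1 ≠ β₃.1 := fun h => h₃ (eq_of_idx_eq hK h hb hd hbd')
  have i₄ : β.1 ≠ β₄.1 := fun h => h₄ (eq_of_idx_eq hK h hk he hke')
  rcases mem_of_triangle hK i₃ i₄ hb hd hk he hf hbd' hfd hke' with h | h <;>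
    rcases mem_of_triangle hK i₃ i₄ hd hb hk he hf hbd'.symm hfb hke' with h' | h' <;>
    subst h <;> simp_all

lemma eq_of_colour (hK : 9 ≤ K) {β β' : Block K r} {i j i' j' : Fin 9}
    (hρ : β.1.2.2 = β'.1.2.2) (hi : β.point i = β'.point i') (hj : β.point j = β'.point j')
    (hij : i ≠ j) (hpair : (i = i' ∧ j = j') ∨ (i = j' ∧ j = i')) : β = β' := by
  have h1 := abscissa_eq hi
  have h2 := abscissa_eq hj
  simp only [abscissa] at h1 h2
  have hne : ((i : ℕ) : ZMod K) - (j : ℕ) ≠ 0 := sub_ne_zero.2 fun h => hij (natCast_inj hK h)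
  rcases hpair with ⟨rfl, rfl⟩ | ⟨rfl, rfl⟩
  · have h3 : (((β.1.2.1 : ℕ) + 1 : ℕ) : ZMod K) = ((β'.1.2.1 : ℕ) + 1 : ℕ) := by
      refine mul_right_cancel₀ hne ?_
      linear_combination h1 - h2
    have hv : β.1.2.1 = β'.1.2.1 := by
      rw [ZMod.natCast_eq_natCast_iff, Nat.ModEq, Nat.mod_eq_of_lt (by omega),
        Nat.mod_eq_of_lt (by omega)] at h3
      exact Fin.ext (by omega)
    rw [h3] at h1
    exact eq_of_idx_eq hK (Prod.ext (add_right_cancel h1) (Prod.ext hv hρ)) hi hj hij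
  · exfalso
    have h3 : (((β.1.2.1 : ℕ) + 1 + (β'.1.2.1 + 1) : ℕ) : ZMod K) = 0 := by
      refine (mul_eq_zero.1 (?_ : _ * (((i : ℕ) : ZMod K) - (j : ℕ)) = 0)).resolve_right hne
      push_cast at h1 h2 ⊢
      linear_combination h1 - h2
    rw [ZMod.natCast_eq_zero_iff] at h3
    have h4 := Nat.le_of_dvd (by omega) h3
    have := β.1.2.1.2
    have := β'.1.2.1.2
    have h5 : K = 2 * (K / 2) := by omega
    have h6 : 2 ∣ K := ⟨_, h5⟩
    have := (Nat.prime_dvd_prime_iff_eq Nat.prime_two (Fact.out : K.Prime)).1 h6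
    omega

end Block

lemma exists_prime_quadraticChar (B N : ℕ) : ∃ Q : ℕ, ∃ _ : Fact Q.Prime, N < Q ∧
    (∀ n : ℤ, n ≠ 0 → n.natAbs ≤ B → ¬ (11 : ℤ) ∣ n → quadraticChar (ZMod Q) n = 1) ∧
    quadraticChar (ZMod Q) ((11 : ℤ) : ZMod Q) = -1 := by
  set M := 4 * (B.factorial / 11 ^ (B.factorial.factorization 11)) with hM
  have hcop : Nat.Coprime M 11 := by
    refine Nat.Coprime.mul_left (by norm_num) ?_
    exact (Nat.coprime_ordCompl (by norm_num) (Nat.factorial_ne_zero _)).symm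
  have hM0 : M ≠ 0 := by
    have := Nat.ordCompl_pos 11 (Nat.factorial_ne_zero B)
    omega
  obtain ⟨a, ha1, ha2⟩ := Nat.chineseRemainder hcop 1 2
  have hunit : IsUnit ((a : ℕ) : ZMod (M * 11)) := by
    rw [ZMod.isUnit_iff_coprime]
    refine Nat.Coprime.mul_right ?_ ?_
    · rw [Nat.Coprime, Nat.ModEq.gcd_eq ha1, Nat.gcd_one_left]
    · rw [Nat.Coprime, Nat.ModEq.gcd_eq ha2]; rfl
  have : NeZero (M * 11) := ⟨by omega⟩
  obtain ⟨Q, hQN, hQ, hQa⟩ := Nat.forall_exists_prime_gt_and_eq_mod hunit N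
  have := Fact.mk hQ
  rw [ZMod.natCast_eq_natCast_iff] at hQa
  have h1 : Q ≡ 1 [MOD M] := (hQa.of_mul_right _).trans ha1
  have h2 : Q ≡ 2 [MOD 11] := (hQa.of_mul_left _).trans ha2
  have h4 : Q ≡ 1 [MOD 4] := h1.of_mul_right _
  have hodd : Odd Q := by
    rw [Nat.odd_iff]; have : Q % 4 = 1 := h4; omega
  refine ⟨Q, ⟨hQ⟩, hQN, fun n hn hnB hn11 => ?_, ?_⟩
  · have hdvd : 4 * n.natAbs ∣ M := by
      refine Nat.mul_dvd_mul_left _ ?_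
      have h11 : Nat.Coprime n.natAbs (11 ^ B.factorial.factorization 11) := by
        refine Nat.Coprime.pow_right _ ?_
        rw [Nat.coprime_comm, Nat.Prime.coprime_iff_not_dvd (by norm_num)]
        intro h; exact hn11 (by omega)
      refine h11.dvd_of_dvd_mul_left ?_
      rw [Nat.ordProj_mul_ordCompl_eq_self]
      exact Nat.dvd_factorial (by omega) hnB
    change legendreSym Q n = 1
    rw [jacobiSym.legendreSym.to_jacobiSym, jacobiSym.mod_right _ hodd, (h1.of_dvd hdvd),
      ← jacobiSym.mod_right _ odd_one, jacobiSym.one_right]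
  · change legendreSym Q 11 = -1
    rw [jacobiSym.legendreSym.to_jacobiSym, jacobiSym.mod_right _ hodd]
    have : Q % (4 * (11 : ℤ).natAbs) = 13 := by
      have e4 : Q % 4 = 1 := h4
      have e11 : Q % 11 = 2 := h2
      change Q % 44 = 13
      omega
    rw [this]
    norm_num

lemma isUnit_zmod_of_mod_factorial {B L : ℕ} (hL : L ≡ 1 [MOD B.factorial]) {n : ℤ} (hn : n ≠ 0)
    (hnB : n.natAbs ≤ B) : IsUnit (n : ZMod L) := by
  have h1 : L ≡ 1 [MOD n.natAbs] := hL.of_dvd (Nat.dvd_factorial (by omega) hnB)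
  have h2 : Nat.Coprime n.natAbs L := by
    rw [Nat.coprime_comm, Nat.Coprime, Nat.ModEq.gcd_eq h1, Nat.gcd_one_left]
  have h3 := (ZMod.isUnit_iff_coprime n.natAbs L).2 h2
  rcases Int.natAbs_eq n with h | h <;> rw [h]
  · simpa using h3
  · simpa using h3

lemma isUnit_zmod_of_lt {B Q : ℕ} [Fact Q.Prime] (hQ : B < Q) {n : ℤ} (hn : n ≠ 0)
    (hnB : n.natAbs ≤ B) : IsUnit (n : ZMod Q) := by
  rw [isUnit_iff_ne_zero, Ne, ZMod.intCast_zmod_eq_zero_iff_dvd, Int.natCast_dvd]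
  intro h
  have := Nat.le_of_dvd (by omega) h
  omega

/-- The pairs of positions covered by an edge of the gadget. -/
def shadowPair : Fin 18 → Fin 9 × Fin 9 :=
  ![(0, 1), (0, 2), (1, 2), (3, 4), (1, 3), (1, 4), (2, 3), (2, 4), (5, 6), (0, 5), (0, 6), (2, 5),
    (2, 6), (7, 8), (0, 7), (0, 8), (1, 7), (1, 8)]

/-- The index `p` is that of the pair `{i, j}`. -/
def IsPair (p : Fin 18) (i j : Fin 9) : Prop := shadowPair p = (i, j) ∨ shadowPair p = (j, i)

instance (p : Fin 18) (i j : Fin 9) : Decidable (IsPair p i j) :=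
  inferInstanceAs (Decidable (_ ∨ _))

lemma Shadow.exists_isPair : ∀ {i j : Fin 9}, Shadow i j → ∃ p, IsPair p i j := by
  decide +kernel

lemma IsPair.unique : ∀ {i j : Fin 9} {p q : Fin 18}, IsPair p i j → IsPair q i j → p = q := by
  decide +kernel

lemma IsPair.eq_or_eq {p : Fin 18} {i j i' j' : Fin 9} (h : IsPair p i j) (h' : IsPair p i' j') :
    (i = i' ∧ j = j') ∨ (i = j' ∧ j = i') := by
  rcases h with h | h <;> rcases h' with h' | h' <;> rw [h] at h' <;>
    simp only [Prod.mk.injEq] at h' <;> grind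

/-- Heights of the positions, chosen modulo `7`. -/
def height : Fin 9 → ℤ := ![0, 1, 3, 5, 6, 4, 6, 2, 6]

/-- The heights used to record a colour: the difference of heights of positions `i, j` is divisible
by `11` exactly when `{i, j}` is the marked pair. -/
def markedHeight (o : Option (Fin 18)) (i : Fin 9) : ℤ :=
  484 * height i + 364 * (o.elim (i : ℤ) fun p =>
    if i = (shadowPair p).2 then ((shadowPair p).1 : ℤ) + 11 else i)

lemma markedHeight_mod_seven (o : Option (Fin 18)) (i : Fin 9) :
    (markedHeight o i : ZMod 7) = height i := by
  have h1 : ((484 : ℤ) : ZMod 7) = 1 := by decide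
  have h2 : ((364 : ℤ) : ZMod 7) = 0 := by decide
  simp only [markedHeight, Int.cast_add, Int.cast_mul, h1, h2]
  ring

lemma abs_markedHeight_le : ∀ o i, |markedHeight o i| ≤ 10000 := by decide +kernel

lemma markedHeight_sub_none : ∀ i j : Fin 9, Claim i j →
    ¬ (11 : ℤ) ∣ markedHeight none i - markedHeight none j := by decide +kernel

lemma markedHeight_sub_some : ∀ (p : Fin 18) (i j : Fin 9), Claim i j →
    if IsPair p i j then (11 : ℤ) ∣ markedHeight (some p) i - markedHeight (some p) j ∧
      ¬ (121 : ℤ) ∣ markedHeight (some p) i - markedHeight (some p) j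
    else ¬ (11 : ℤ) ∣ markedHeight (some p) i - markedHeight (some p) j := by decide +kernel

/-- The ordered edges of the gadget. -/
def triList : List (Fin 9 × Fin 9 × Fin 9) :=
  [(0, 1, 2), (3, 4, 1), (3, 4, 2), (5, 6, 0), (5, 6, 2), (7, 8, 0), (7, 8, 1)].flatMap
    fun x => [x, (x.1, x.2.2, x.2.1), (x.2.1, x.1, x.2.2), (x.2.1, x.2.2, x.1),
      (x.2.2, x.1, x.2.1), (x.2.2, x.2.1, x.1)]

lemma Tri.mem_triList : ∀ {i j k : Fin 9}, Tri i j k → (i, j, k) ∈ triList := by decide +kernel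

lemma cross_height_ne_zero : triList.all (fun x => triList.all fun y =>
    decide (cross (fun i => (height i : ZMod 7)) (fun i => (height i : ZMod 7))
      x.1 x.2.1 x.2.2 y.1 y.2.1 y.2.2 ≠ 0)) = true := by
  decide +kernel

lemma cross_markedHeight_ne_zero (o o' : Option (Fin 18)) {a b c a' b' c' : Fin 9}
    (h : Tri a b c) (h' : Tri a' b' c') :
    cross (markedHeight o) (markedHeight o') a b c a' b' c' ≠ 0 := by
  intro h0
  have := congrArg (Int.cast : ℤ → ZMod 7) h0
  simp only [cross, Int.cast_add, Int.cast_mul, Int.cast_sub, markedHeight_mod_seven,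
    Int.cast_zero] at this
  exact of_decide_eq_true (List.all_eq_true.1 (List.all_eq_true.1 cross_height_ne_zero _
    h.mem_triList) _ h'.mem_triList) this

lemma natAbs_cross_le {z w : Fin 9 → ℤ} (hz : ∀ i, |z i| ≤ 10000) (hw : ∀ i, |w i| ≤ 10000)
    (a b c a' b' c' : Fin 9) : (cross z w a b c a' b' c').natAbs ≤ 10 ^ 9 := by
  have h1 : ∀ i j, |z i - z j| ≤ 20000 := fun i j => (abs_sub _ _).trans (by linarith [hz i, hz j])
  have h2 : ∀ i j, |w i - w j| ≤ 20000 := fun i j => (abs_sub _ _).trans (by linarith [hw i, hw j])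
  have h3 : |cross z w a b c a' b' c'| ≤ 20000 * 20000 + 20000 * 20000 := by
    refine (abs_add_le _ _).trans (add_le_add ?_ ?_) <;> rw [abs_mul] <;>
      exact mul_le_mul (h1 _ _) (h2 _ _) (abs_nonneg _) (by norm_num)
  rw [Int.abs_eq_natAbs] at h3
  omega

/-- Heights for which all differences occurring within one block are nonzero. -/
structure IsGood (z : Fin 9 → ℤ) : Prop where
  abs_le : ∀ i, |z i| ≤ 10000
  sub_ne_zero : ∀ i j, Shadow i j → z i - z j ≠ 0
  cross_ne_zero : ∀ a a' b c, Tri a b c → Tri a' b c → cross z z a b c a' b c ≠ 0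

lemma isGood_markedHeight (o : Option (Fin 18)) : IsGood (markedHeight o) where
  abs_le := abs_markedHeight_le o
  sub_ne_zero i j h := by
    intro h0
    cases o with
    | none => exact markedHeight_sub_none i j (Or.inl h) (by simp [h0])
    | some p =>
      have := markedHeight_sub_some p i j (Or.inl h)
      simp [h0] at this
  cross_ne_zero _ _ _ _ h h' := cross_markedHeight_ne_zero o o h h'

/-- Heights taking prescribed values at the positions `p, q, r`. -/
def prescribed (v₀ v₁ v₂ : ℤ) (p q r i : Fin 9) : ℤ :=
  if i = p then v₀ else if i = q then v₁ else if i = r then v₂ else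
    (![31, 23, 42, 58, 24, 48, 52, 59, 13] : Fin 9 → ℤ) i

/-- The values prescribed on the edges of the four blocks of a Pasch configuration. -/
def paschValue : Fin 4 → ℤ × ℤ × ℤ := ![(1, -1, 0), (0, 3, 2), (1, 0, -1), (1, 0, -2)]

/-- Heights adapted to the `m`-th edge of a Pasch configuration. -/
def paschHeight (m : Fin 4) (p q r : Fin 9) : Fin 9 → ℤ :=
  prescribed (paschValue m).1 (paschValue m).2.1 (paschValue m).2.2 p q r

lemma paschHeight_fst (m : Fin 4) (p q r : Fin 9) :
    paschHeight m p q r p = (paschValue m).1 := by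
  simp [paschHeight, prescribed]

lemma paschHeight_snd (m : Fin 4) {p q r : Fin 9} (h : Tri p q r) :
    paschHeight m p q r q = (paschValue m).2.1 := by
  simp [paschHeight, prescribed, h.ne.1.symm]

lemma paschHeight_thd (m : Fin 4) {p q r : Fin 9} (h : Tri p q r) :
    paschHeight m p q r r = (paschValue m).2.2 := by
  simp [paschHeight, prescribed, h.ne.2.1.symm, h.ne.2.2.symm]

/-- The pairs of ordered edges of the gadget sharing their last two vertices. -/
def crossList : List ((Fin 9 × Fin 9) × Fin 9 × Fin 9) :=
  triList.flatMap fun x => (triList.filter fun y => y.2 = x.2).map fun y => ((x.1, y.1), x.2)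

lemma mem_crossList {a a' b c : Fin 9} (h : Tri a b c) (h' : Tri a' b c) :
    ((a, a'), b, c) ∈ crossList := by
  simp only [crossList, List.mem_flatMap, List.mem_map, List.mem_filter, decide_eq_true_eq]
  exact ⟨_, h.mem_triList, _, ⟨h'.mem_triList, rfl⟩, rfl⟩

lemma paschHeight_check : ∀ m : Fin 4, triList.all (fun x =>
    decide ((∀ i, |paschHeight m x.1 x.2.1 x.2.2 i| ≤ 10000) ∧
      ∀ p : Fin 18, paschHeight m x.1 x.2.1 x.2.2 (shadowPair p).1 ≠
        paschHeight m x.1 x.2.1 x.2.2 (shadowPair p).2) &&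
    crossList.all fun y =>
      decide (cross (paschHeight m x.1 x.2.1 x.2.2) (paschHeight m x.1 x.2.1 x.2.2)
        y.1.1 y.2.1 y.2.2 y.1.2 y.2.1 y.2.2 ≠ 0)) = true := by
  decide +kernel

lemma isGood_paschHeight (m : Fin 4) {p q r : Fin 9} (h : Tri p q r) :
    IsGood (paschHeight m p q r) := by
  have key := List.all_eq_true.1 (paschHeight_check m) _ h.mem_triList
  rw [Bool.and_eq_true, decide_eq_true_eq] at key
  obtain ⟨⟨h₁, h₂⟩, h₃⟩ := key
  refine ⟨h₁, fun i j hij => ?_, fun _ _ _ _ ha ha' => ?_⟩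
  · obtain ⟨s, hs⟩ := hij.exists_isPair
    have := h₂ s
    rcases hs with hs | hs <;> rw [hs] at this
    · exact sub_ne_zero.2 this
    · exact sub_ne_zero.2 this.symm
  · exact of_decide_eq_true (List.all_eq_true.1 h₃ _ (mem_crossList ha ha'))

section Units

variable {A : Type*} [CommRing A]

lemma cast_cross (z w : Fin 9 → ℤ) (a b c a' b' c' : Fin 9) :
    ((cross z w a b c a' b' c' : ℤ) : A) =
      cross (fun i => (z i : A)) (fun i => (w i : A)) a b c a' b' c' := by
  simp [cross]

variable (hA : ∀ n : ℤ, n ≠ 0 → n.natAbs ≤ 10 ^ 9 → IsUnit (n : A))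
include hA

lemma IsGood.isUnit_sub {z : Fin 9 → ℤ} (hz : IsGood z) {i j : Fin 9} (h : Shadow i j) :
    IsUnit ((z i : A) - z j) := by
  rw [← Int.cast_sub]
  refine hA _ (hz.sub_ne_zero i j h) ?_
  have h1 := _root_.abs_le.1 (hz.abs_le i)
  have h2 := _root_.abs_le.1 (hz.abs_le j)
  omega

lemma IsGood.isUnit_cross {z : Fin 9 → ℤ} (hz : IsGood z) {a a' b c : Fin 9} (h : Tri a b c)
    (h' : Tri a' b c) :
    IsUnit (cross (fun i => (z i : A)) (fun i => (z i : A)) a b c a' b c) := by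
  rw [← cast_cross]
  exact hA _ (hz.cross_ne_zero _ _ _ _ h h') (natAbs_cross_le hz.abs_le hz.abs_le _ _ _ _ _ _)

lemma isUnit_cross_markedHeight (o o' : Option (Fin 18)) {a b c a' b' c' : Fin 9} (h : Tri a b c)
    (h' : Tri a' b' c') : IsUnit (cross (fun i => (markedHeight o i : A))
      (fun i => (markedHeight o' i : A)) a b c a' b' c') := by
  rw [← cast_cross]
  exact hA _ (cross_markedHeight_ne_zero o o' h h')
    (natAbs_cross_le (abs_markedHeight_le o) (abs_markedHeight_le o') _ _ _ _ _ _)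

end Units

section QuadraticChar

variable {Q : ℕ} [Fact Q.Prime]

lemma quadraticChar_markedHeight_sub
    (h1 : ∀ n : ℤ, n ≠ 0 → n.natAbs ≤ 10 ^ 9 → ¬ (11 : ℤ) ∣ n → quadraticChar (ZMod Q) n = 1)
    (h11 : quadraticChar (ZMod Q) ((11 : ℤ) : ZMod Q) = -1) (o : Option (Fin 18)) {i j : Fin 9}
    (h : Claim i j) :
    quadraticChar (ZMod Q) ((markedHeight o i : ZMod Q) - markedHeight o j) =
      if ∃ p, o = some p ∧ IsPair p i j then -1 else 1 := by
  have hi := abs_le.1 (abs_markedHeight_le o i)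
  have hj := abs_le.1 (abs_markedHeight_le o j)
  have hle : (markedHeight o i - markedHeight o j).natAbs ≤ 10 ^ 9 := by omega
  have key : ¬ (11 : ℤ) ∣ markedHeight o i - markedHeight o j →
      quadraticChar (ZMod Q) ((markedHeight o i : ZMod Q) - markedHeight o j) = 1 := by
    intro hd
    rw [← Int.cast_sub]
    exact h1 _ (fun h0 => hd (h0 ▸ dvd_zero _)) hle hd
  cases o with
  | none => simpa using key (markedHeight_sub_none i j h)
  | some p =>
    have hp := markedHeight_sub_some p i j h
    by_cases hpair : IsPair p i j
    · simp only [hpair, if_true] at hp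
      obtain ⟨⟨m, hm⟩, hm'⟩ := hp
      rw [← Int.cast_sub, hm, Int.cast_mul, map_mul, h11, h1 m (by omega) (by omega) (by omega)]
      simp [hpair]
    · simp only [hpair, if_false] at hp
      simpa [hpair] using key hp

end QuadraticChar

section Coordinates

variable {B : Type*}

/-- Data selecting, for each block, an ordered edge of the gadget and its rank in a Pasch
configuration. -/
abbrev Choice (B : Type*) : Type _ := B → Fin 4 × Fin 9 × Fin 9 × Fin 9

/-- Heights in the coordinate excluding a given Pasch configuration. -/
def choiceHeight (κ : Choice B) (β : B) : Fin 9 → ℤ :=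
  if Tri (κ β).2.1 (κ β).2.2.1 (κ β).2.2.2 then
    paschHeight (κ β).1 (κ β).2.1 (κ β).2.2.1 (κ β).2.2.2
  else markedHeight none

/-- Offsets in the coordinate excluding a given Pasch configuration. -/
def choiceOffset (κ : Choice B) (β : B) (i : Fin 9) : ℤ :=
  if (κ β).1 = 0 ∧ i = (κ β).2.1 then 1 else 0

lemma isGood_choiceHeight (κ : Choice B) (β : B) : IsGood (choiceHeight κ β) := by
  unfold choiceHeight
  split_ifs with h
  · exact isGood_paschHeight _ h
  · exact isGood_markedHeight _

lemma choiceHeight_eq {κ : Choice B} {β : B} {m : Fin 4} {p q r : Fin 9} (h : κ β = (m, p, q, r))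
    (ht : Tri p q r) : choiceHeight κ β p = (paschValue m).1 ∧
      choiceHeight κ β q = (paschValue m).2.1 ∧ choiceHeight κ β r = (paschValue m).2.2 := by
  simp only [choiceHeight, h, ht, if_true]
  exact ⟨paschHeight_fst _ _ _ _, paschHeight_snd _ ht, paschHeight_thd _ ht⟩

lemma choiceOffset_eq {κ : Choice B} {β : B} {m : Fin 4} {p q r : Fin 9} (h : κ β = (m, p, q, r))
    (ht : Tri p q r) : choiceOffset κ β p = (if m = 0 then 1 else 0) ∧
      choiceOffset κ β q = 0 ∧ choiceOffset κ β r = 0 := by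
  simp [choiceOffset, h, ht.ne.1.symm, ht.ne.2.1.symm]

lemma exists_choice (β₁ β₂ β₃ β₄ : B) (hβ : [β₁, β₂, β₃, β₄].Nodup)
    (x₁ x₂ x₃ x₄ : Fin 4 × Fin 9 × Fin 9 × Fin 9) :
    ∃ κ : Choice B, κ β₁ = x₁ ∧ κ β₂ = x₂ ∧ κ β₃ = x₃ ∧ κ β₄ = x₄ := by
  classical
  simp only [List.nodup_cons, List.mem_cons, List.not_mem_nil, or_false, not_or] at hβ
  refine ⟨fun β => if β = β₁ then x₁ else if β = β₂ then x₂ else if β = β₃ then x₃ else x₄,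
    ?_, ?_, ?_, ?_⟩ <;> simp <;> grind

lemma not_pasch_of_choice {A : Type*} [CommRing A] [Nontrivial A] {κ : Choice B}
    {β₁ β₂ β₃ β₄ : B} {a₁ a₂ b₁ b₃ k₁ k₄ d₂ d₃ e₂ e₄ f₃ f₄ : Fin 9}
    (h₁ : Tri a₁ b₁ k₁) (h₂ : Tri a₂ d₂ e₂) (h₃ : Tri b₃ d₃ f₃) (h₄ : Tri k₄ e₄ f₄)
    (κ₁ : κ β₁ = (0, a₁, b₁, k₁)) (κ₂ : κ β₂ = (1, a₂, d₂, e₂)) (κ₃ : κ β₃ = (2, b₃, d₃, f₃))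
    (κ₄ : κ β₄ = (3, k₄, e₄, f₄)) {z o : B → Fin 9 → A}
    (hz : ∀ β i, z β i = choiceHeight κ β i) (ho : ∀ β i, o β i = choiceOffset κ β i)
    {s₁ t₁ s₂ t₂ s₃ t₃ s₄ t₄ : A}
    (ha : s₁ + z β₁ a₁ * t₁ + o β₁ a₁ = s₂ + z β₂ a₂ * t₂ + o β₂ a₂)
    (hb : s₁ + z β₁ b₁ * t₁ + o β₁ b₁ = s₃ + z β₃ b₃ * t₃ + o β₃ b₃)
    (hk : s₁ + z β₁ k₁ * t₁ + o β₁ k₁ = s₄ + z β₄ k₄ * t₄ + o β₄ k₄)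
    (hd : s₂ + z β₂ d₂ * t₂ + o β₂ d₂ = s₃ + z β₃ d₃ * t₃ + o β₃ d₃)
    (he : s₂ + z β₂ e₂ * t₂ + o β₂ e₂ = s₄ + z β₄ e₄ * t₄ + o β₄ e₄)
    (hf : s₃ + z β₃ f₃ * t₃ + o β₃ f₃ = s₄ + z β₄ f₄ * t₄ + o β₄ f₄) : False := by
  obtain ⟨z1, z2, z3⟩ := choiceHeight_eq κ₁ h₁
  obtain ⟨z4, z5, z6⟩ := choiceHeight_eq κ₂ h₂
  obtain ⟨z7, z8, z9⟩ := choiceHeight_eq κ₃ h₃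
  obtain ⟨z10, z11, z12⟩ := choiceHeight_eq κ₄ h₄
  obtain ⟨o1, o2, o3⟩ := choiceOffset_eq κ₁ h₁
  obtain ⟨o4, o5, o6⟩ := choiceOffset_eq κ₂ h₂
  obtain ⟨o7, o8, o9⟩ := choiceOffset_eq κ₃ h₃
  obtain ⟨o10, o11, o12⟩ := choiceOffset_eq κ₄ h₄
  simp only [hz, ho, z1, z2, z3, z4, z5, z6, z7, z8, z9, z10, z11, z12, o1, o2, o3, o4, o5, o6, o7,
    o8, o9, o10, o11, o12, paschValue, Matrix.cons_val] at ha hb hk hd he hf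
  simp only [if_true, if_false, Fin.reduceEq, Int.cast_zero, Int.cast_one, Int.cast_neg,
    Int.cast_ofNat] at ha hb hk hd he hf
  refine one_ne_zero (α := A) ?_
  linear_combination ha + hb - 2 * hk - 2 * hd + 3 * he - hf

end Coordinates

section Colours

variable {r k : ℕ} (cod : Fin r × Fin 18 → Fin k → Bool)

/-- The pair marked in a coordinate for blocks with a given colour. -/
def marked (ρ : Fin r) (x : Fin k × Fin 18) : Option (Fin 18) :=
  if cod (ρ, x.2) x.1 then some x.2 else none

variable {cod} {Q : ℕ} [Fact Q.Prime]
  (h1 : ∀ n : ℤ, n ≠ 0 → n.natAbs ≤ 10 ^ 9 → ¬ (11 : ℤ) ∣ n → quadraticChar (ZMod Q) n = 1)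
  (h11 : quadraticChar (ZMod Q) ((11 : ℤ) : ZMod Q) = -1)
include h1 h11

lemma prod_quadraticChar_marked (ρ : Fin r) (l : Fin k) {i j : Fin 9} (h : Claim i j) :
    ∏ p, quadraticChar (ZMod Q) ((markedHeight (marked cod ρ (l, p)) i : ZMod Q) -
      markedHeight (marked cod ρ (l, p)) j) =
      if ∃ p, IsPair p i j ∧ cod (ρ, p) l = true then -1 else 1 := by
  have key : ∀ p, quadraticChar (ZMod Q) ((markedHeight (marked cod ρ (l, p)) i : ZMod Q) -
      markedHeight (marked cod ρ (l, p)) j) = if IsPair p i j ∧ cod (ρ, p) l = true then -1 else 1 := by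
    intro p
    rw [quadraticChar_markedHeight_sub h1 h11 _ h]
    refine if_congr ?_ rfl rfl
    simp only [marked]
    split_ifs with hc <;> simp [hc]
  simp only [key]
  split_ifs with hex
  · obtain ⟨p, hp, hc⟩ := hex
    rw [prod_eq_single p (fun q _ hq => if_neg fun h => hq (h.1.unique hp)) (by simp)]
    simp [hp, hc]
  · push Not at hex
    exact prod_eq_one fun p _ => if_neg fun h => hex p h.1 h.2

lemma eq_of_marked (hcod : Function.Injective cod) (hcod0 : ∀ x, cod x ≠ fun _ => false)
    {c : Fin k → ℤ} (hc : ∀ l, c l ≠ 0) {ρ ρ' : Fin r} {t t' : Fin k × Fin 18 → ZMod Q}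
    (ht : ∀ l, ∏ p, quadraticChar (ZMod Q) (t (l, p)) = c l)
    (ht' : ∀ l, ∏ p, quadraticChar (ZMod Q) (t' (l, p)) = c l) {i j i' j' : Fin 9}
    (h : Shadow i j) (h' : Claim i' j')
    (heq : ∀ x, ((markedHeight (marked cod ρ x) i : ZMod Q) - markedHeight (marked cod ρ x) j) * t x =
      ((markedHeight (marked cod ρ' x) i' : ZMod Q) - markedHeight (marked cod ρ' x) j') * t' x) :
    ρ = ρ' ∧ ((i = i' ∧ j = j') ∨ (i = j' ∧ j = i')) := by
  have key : ∀ l, (∃ p, IsPair p i j ∧ cod (ρ, p) l = true) ↔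
      ∃ p, IsPair p i' j' ∧ cod (ρ', p) l = true := by
    intro l
    have := Finset.prod_congr rfl fun p (_ : p ∈ univ) =>
      congrArg (quadraticChar (ZMod Q)) (heq (l, p))
    simp only [map_mul, prod_mul_distrib, ht, ht', prod_quadraticChar_marked h1 h11 _ _ (Or.inl h),
      prod_quadraticChar_marked h1 h11 _ _ h'] at this
    have := mul_right_cancel₀ (hc l) this
    by_cases e : ∃ p, IsPair p i j ∧ cod (ρ, p) l = true <;>
      by_cases e' : ∃ p, IsPair p i' j' ∧ cod (ρ', p) l = true <;> simp [e, e'] at this ⊢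
  obtain ⟨p, hp⟩ := h.exists_isPair
  have h2 : ∀ l, cod (ρ, p) l = true ↔ ∃ p, IsPair p i' j' ∧ cod (ρ', p) l = true := fun l => by
    rw [← key]
    exact ⟨fun h => ⟨p, hp, h⟩, fun ⟨q, hq, h⟩ => hq.unique hp ▸ h⟩
  obtain ⟨l, hl⟩ := Function.ne_iff.1 (hcod0 (ρ, p))
  obtain ⟨q, hq, -⟩ := (h2 l).1 (by simpa using hl)
  have h3 : cod (ρ, p) = cod (ρ', q) := funext fun l => by
    rw [Bool.eq_iff_iff, h2]
    exact ⟨fun ⟨q', hq', h⟩ => hq'.unique hq ▸ h, fun h => ⟨q, hq, h⟩⟩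
  have h4 := Prod.ext_iff.1 (hcod h3)
  exact ⟨h4.1, hp.eq_or_eq (by rw [show p = q from h4.2]; exact hq)⟩

end Colours

section Transfer

lemma isFree_map {V W : Type*} [DecidableEq V] [DecidableEq W] (f : V ↪ W)
    {G : Finset (Finset V)} {s k : ℕ} (hG : IsFree G s k) :
    IsFree (G.map (mapEmbedding f).toEmbedding) s k := by
  rintro ⟨S, hS, hk, hs⟩
  obtain ⟨S', hS', rfl⟩ := subset_map_iff.1 hS
  refine hG ⟨S', hS', by simpa using hk, ?_⟩
  have : (S'.map (mapEmbedding f).toEmbedding).sup id = (S'.sup id).map f := by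
    ext x
    simp only [Finset.mem_sup, Finset.mem_map, id]
    constructor
    · rintro ⟨_, ⟨e, he, rfl⟩, hx⟩
      obtain ⟨y, hy, rfl⟩ := Finset.mem_map.1 hx
      exact ⟨y, ⟨e, he, hy⟩, rfl⟩
    · rintro ⟨y, ⟨e, he, hy⟩, rfl⟩
      exact ⟨_, ⟨e, he, rfl⟩, mem_map_of_mem f hy⟩
  rwa [this, card_map] at hs

lemma bddAbove_exNum (r n s k : ℕ) : BddAbove {m : ℕ | ∃ G : Finset (Finset (Fin n)),
    (∀ e ∈ G, e.card = r) ∧ IsFree G s k ∧ G.card = m} := by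
  refine ⟨Fintype.card (Finset (Fin n)), ?_⟩
  rintro m ⟨G, -, -, rfl⟩
  exact card_le_univ G

lemma card_le_exNum {V : Type*} {_ : DecidableEq V} [Finite V] {n : ℕ} (hn : Nat.card V ≤ n)
    {G : Finset (Finset V)} {r s k : ℕ} (hr : ∀ e ∈ G, e.card = r) (hG : IsFree G s k) :
    G.card ≤ exNum r n s k := by
  have := Fintype.ofFinite V
  rw [Nat.card_eq_fintype_card] at hn
  obtain ⟨f⟩ : Nonempty (V ↪ Fin n) := Function.Embedding.nonempty_of_card_le (by simpa using hn)
  refine le_csSup (bddAbove_exNum r n s k) ⟨_, ?_, isFree_map f hG, card_map _⟩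
  intro e he
  obtain ⟨e', he', rfl⟩ := Finset.mem_map.1 he
  simpa using hr e' he'

end Transfer

section Template

variable {K r k Q L : ℕ}

/-- The ring acting on the copies of each block. -/
abbrev Offset (K r k Q L : ℕ) : Type :=
  (Fin k × Fin 18 → ZMod Q) × (Choice (Block K r) → ZMod Q) × ZMod L

/-- The heights of the positions of a block. -/
def blockHeight (cod : Fin r × Fin 18 → Fin k → Bool) (Q L : ℕ) (β : Block K r) (i : Fin 9) :
    Offset K r k Q L :=
  (fun x => (markedHeight (marked cod β.1.2.2 x) i : ZMod Q),
    fun κ => (choiceHeight κ β i : ZMod Q), (markedHeight none i : ZMod L))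

lemma exists_isFree_template [Fact K.Prime] (hK : 9 ≤ K) [Fact Q.Prime]
    (hQ : ∀ n : ℤ, n ≠ 0 → n.natAbs ≤ 10 ^ 9 → IsUnit (n : ZMod Q))
    (hL : ∀ n : ℤ, n ≠ 0 → n.natAbs ≤ 10 ^ 9 → IsUnit (n : ZMod L)) [NeZero L]
    (h1 : ∀ n : ℤ, n ≠ 0 → n.natAbs ≤ 10 ^ 9 → ¬ (11 : ℤ) ∣ n → quadraticChar (ZMod Q) n = 1)
    (h11 : quadraticChar (ZMod Q) ((11 : ℤ) : ZMod Q) = -1)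
    {cod : Fin r × Fin 18 → Fin k → Bool} (hcod : Function.Injective cod)
    (hcod0 : ∀ x, cod x ≠ fun _ => false) {c : Fin k → ℤ} (hc : ∀ l, c l ≠ 0)
    (T : Finset (Offset K r k Q L))
    (hT : ∀ t ∈ T, ∀ l, ∏ p, quadraticChar (ZMod Q) (t.1 (l, p)) = c l) :
    7 * (Nat.card (Block K r) * (Nat.card (Offset K r k Q L) * T.card)) ≤
      exNum 3 (Nat.card (Point K r) * Nat.card (Offset K r k Q L)) 6 4 := by
  classical
  let layout : Layout (Point K r) (Block K r) (Offset K r k Q L) (Fin k × Fin 18 → ZMod Q) :=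
    { φ := Block.point
      z := blockHeight cod Q L
      o := fun β i => (0, fun κ => (choiceOffset κ β i : ZMod Q), 0)
      T := T
      π := RingHom.fst _ _
      φ_inj := Block.point_inj hK
      isUnit_sub := fun β i j h => by
        refine Prod.isUnit_iff.2 ⟨Pi.isUnit_iff.2 fun x => ?_,
          Prod.isUnit_iff.2 ⟨Pi.isUnit_iff.2 fun κ => ?_, ?_⟩⟩
        · exact (isGood_markedHeight _).isUnit_sub hQ h
        · exact (isGood_choiceHeight κ β).isUnit_sub hQ h
        · exact (isGood_markedHeight _).isUnit_sub hL h
      isUnit_cross := fun β a a' b c h h' => by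
        refine Prod.isUnit_iff.2 ⟨Pi.isUnit_iff.2 fun x => ?_,
          Prod.isUnit_iff.2 ⟨Pi.isUnit_iff.2 fun κ => ?_, ?_⟩⟩
        · exact (isGood_markedHeight _).isUnit_cross hQ h h'
        · exact (isGood_choiceHeight κ β).isUnit_cross hQ h h'
        · exact (isGood_markedHeight _).isUnit_cross hL h h'
      isUnit_cross_π := fun β β' a b c a' b' c' h h' =>
        Pi.isUnit_iff.2 fun x => isUnit_cross_markedHeight hQ _ _ h h'
      π_o := fun _ _ => rfl
      colour := fun β β' i j i' j' t ht t' ht' h h' hi hj heq => by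
        obtain ⟨hρ, hpair⟩ := eq_of_marked h1 h11 hcod hcod0 hc (hT t ht) (hT t' ht') h h'
          (congrFun heq)
        exact Block.eq_of_colour hK hρ hi hj h.ne hpair
      eq_of_three := Block.eq_of_three hK
      eq_of_triangle := Block.eq_of_triangle hK
      kill := fun β₁ β₂ β₃ β₄ a₁ a₂ b₁ b₃ k₁ k₄ d₂ d₃ e₂ e₄ f₃ f₄ hβ h₁ h₂ h₃ h₄
          s₁ t₁ s₂ t₂ s₃ t₃ s₄ t₄ ha hb hk hd he hf => by
        obtain ⟨κ, κ₁, κ₂, κ₃, κ₄⟩ := exists_choice β₁ β₂ β₃ β₄ hβ (0, a₁, b₁, k₁) (1, a₂, d₂, e₂)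
          (2, b₃, d₃, f₃) (3, k₄, e₄, f₄)
        exact not_pasch_of_choice h₁ h₂ h₃ h₄ κ₁ κ₂ κ₃ κ₄
          (z := fun β i => (blockHeight cod Q L β i).2.1 κ)
          (o := fun β i => (choiceOffset κ β i : ZMod Q)) (fun _ _ => rfl) (fun _ _ => rfl)
          (congrFun (congrArg (fun x => x.2.1) ha) κ) (congrFun (congrArg (fun x => x.2.1) hb) κ)
          (congrFun (congrArg (fun x => x.2.1) hk) κ) (congrFun (congrArg (fun x => x.2.1) hd) κ)
          (congrFun (congrArg (fun x => x.2.1) he) κ) (congrFun (congrArg (fun x => x.2.1) hf) κ) }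
  have := Fintype.ofFinite (Point K r)
  have := Fintype.ofFinite (Block K r)
  have := Fintype.ofFinite (Offset K r k Q L)
  obtain ⟨G, h3, hG, hcard⟩ := layout.exists_isFree
  rw [Nat.card_eq_fintype_card (α := Block K r), Nat.card_eq_fintype_card (α := Offset K r k Q L),
    ← hcard, ← Nat.card_eq_fintype_card (α := Offset K r k Q L)]
  exact card_le_exNum (Nat.card_prod _ _).le h3 hG

end Template

lemma exNum_mono (r s k : ℕ) {m n : ℕ} (h : m ≤ n) : exNum r m s k ≤ exNum r n s k := by
  refine csSup_le' ?_
  rintro _ ⟨G, hr, hG, rfl⟩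
  exact card_le_exNum (by simpa using h) hr hG

lemma card_sup_le_of_pair {n : ℕ} {S : Finset (Finset (Fin n))} {x y : Fin n} (hxy : x ≠ y)
    (hS : ∀ e ∈ S, e.card = 3 ∧ x ∈ e ∧ y ∈ e) : (S.sup id).card ≤ S.card + 2 := by
  have hsub : S.sup id ⊆ {x, y} ∪ S.biUnion fun e => e \ {x, y} := by
    intro v hv
    obtain ⟨e, he, hve⟩ := Finset.mem_sup.1 hv
    by_cases h : v ∈ ({x, y} : Finset (Fin n))
    · exact mem_union_left _ h
    · exact mem_union_right _ (mem_biUnion.2 ⟨e, he, mem_sdiff.2 ⟨hve, h⟩⟩)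
  have h1 : (S.biUnion fun e => e \ {x, y}).card ≤ S.card * 1 := by
    refine card_biUnion_le_card_mul _ _ _ fun e he => ?_
    have hsub : ({x, y} : Finset (Fin n)) ⊆ e := by
      simp [insert_subset_iff, (hS e he).2]
    rw [card_sdiff_of_subset hsub, (hS e he).1, card_pair hxy]
  have h2 := (card_le_card hsub).trans (card_union_le _ _)
  rw [card_pair hxy] at h2
  omega

lemma exNum_le (n : ℕ) : exNum 3 n 6 4 ≤ 3 * n ^ 2 := by
  refine csSup_le' ?_
  rintro _ ⟨G, hr, hG, rfl⟩
  have hpair : ∀ e : Finset (Fin n), e ∈ G → ∃ p : Fin n × Fin n, p.1 ≠ p.2 ∧ p.1 ∈ e ∧ p.2 ∈ e := by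
    intro e he
    obtain ⟨x, hx, y, hy, hxy⟩ := one_lt_card.1 (by rw [hr e he]; norm_num : 1 < e.card)
    exact ⟨(x, y), hxy, hx, hy⟩
  rcases G.eq_empty_or_nonempty with rfl | ⟨e₀, he₀⟩
  · simp
  have : Nonempty (Fin n × Fin n) := (hpair e₀ he₀).nonempty
  choose! g hg using hpair
  have hfib : ∀ p ∈ G.image g, (G.filter fun e => g e = p).card ≤ 3 := by
    intro p _
    by_contra! hlt
    obtain ⟨S, hS, hS4⟩ := exists_subset_card_eq (Nat.succ_le_of_lt hlt)
    have hS' : ∀ e ∈ S, e ∈ G ∧ g e = p := fun e he => mem_filter.1 (hS he)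
    obtain ⟨e, he⟩ : S.Nonempty := card_pos.1 (by omega)
    have hne : p.1 ≠ p.2 := (hS' e he).2 ▸ (hg e (hS' e he).1).1
    refine hG ⟨S, fun e he => (hS' e he).1, hS4, ?_⟩
    refine (card_sup_le_of_pair hne fun e he => ⟨hr e (hS' e he).1, ?_⟩).trans (by omega)
    have h := (hg e (hS' e he).1).2
    rwa [(hS' e he).2] at h
  refine (card_le_mul_card_image G 3 hfib).trans (Nat.mul_le_mul_left 3 ?_)
  refine (card_le_univ _).trans ?_
  simp [sq]

section Count

lemma exists_modulus (B : ℕ) : ∃ M > 0, ∀ L : ℕ, L ≡ 1 [MOD M] → ∀ n : ℤ, n ≠ 0 → n.natAbs ≤ B →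
    IsUnit (n : ZMod L) :=
  ⟨B.factorial, B.factorial_pos, fun _ hL _ hn hnB => isUnit_zmod_of_mod_factorial hL hn hnB⟩

lemma exists_code {r k : ℕ} (h : r * 18 < 2 ^ k) : ∃ cod : Fin r × Fin 18 → Fin k → Bool,
    Function.Injective cod ∧ ∀ x, cod x ≠ fun _ => false := by
  obtain ⟨f⟩ : Nonempty (Fin r × Fin 18 ↪ {w : Fin k → Bool // w ≠ fun _ => false}) := by
    refine Function.Embedding.nonempty_of_card_le ?_
    rw [Fintype.card_subtype_compl]
    simp
    omega
  exact ⟨fun x => f x, Subtype.val_injective.comp f.injective, fun x => (f x).2⟩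

variable {K r k Q L : ℕ} [Fact K.Prime] [Fact Q.Prime] [NeZero L]

lemma exists_large_fiber : ∃ c : Fin k → ℤ, (∀ l, c l ≠ 0) ∧ ∃ T : Finset (Offset K r k Q L),
    (∀ t ∈ T, ∀ l, ∏ p, quadraticChar (ZMod Q) (t.1 (l, p)) = c l) ∧
    (Q - 1) ^ (k * 18) * (Nat.card (Choice (Block K r) → ZMod Q) * L) ≤ 2 ^ k * T.card := by
  classical
  have := Fintype.ofFinite (Choice (Block K r) → ZMod Q)
  let U : Finset (Offset K r k Q L) :=
    (Fintype.piFinset fun _ => univ.erase (0 : ZMod Q)) ×ˢ (univ ×ˢ univ)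
  let F : Offset K r k Q L → Fin k → ℤ := fun t l => ∏ p, quadraticChar (ZMod Q) (t.1 (l, p))
  let V : Finset (Fin k → ℤ) := Fintype.piFinset fun _ => {1, -1}
  have hF : ∀ t ∈ U, F t ∈ V := by
    intro t ht
    have ht0 : ∀ x, t.1 x ≠ 0 := fun x =>
      (mem_erase.1 (Fintype.mem_piFinset.1 (mem_product.1 ht).1 x)).1
    refine Fintype.mem_piFinset.2 fun l => ?_
    have h : F t l = quadraticChar (ZMod Q) (∏ p, t.1 (l, p)) := (map_prod _ _ _).symm
    rw [h, mem_insert, mem_singleton]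
    exact quadraticChar_dichotomy (prod_ne_zero_iff.2 fun p _ => ht0 _)
  have hV : V.card = 2 ^ k := by simp [V]
  have hU : U.card = (Q - 1) ^ (k * 18) * (Nat.card (Choice (Block K r) → ZMod Q) * L) := by
    simp only [U, card_product, Fintype.card_piFinset, prod_const, card_erase_of_mem (mem_univ _),
      card_univ, ZMod.card, Fintype.card_prod, Fintype.card_fin, Nat.card_eq_fintype_card]
  obtain ⟨c, hcV, hc⟩ : ∃ c ∈ V, U.card ≤ 2 ^ k * (U.filter fun t => F t = c).card := by
    by_contra! hlt
    have h1 := card_eq_sum_card_fiberwise (s := U) (t := V) hF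
    have h2 : ∑ c ∈ V, 2 ^ k * (U.filter fun t => F t = c).card < ∑ c ∈ V, U.card :=
      sum_lt_sum_of_nonempty ⟨fun _ => 1, by simp [V]⟩ hlt
    rw [← mul_sum, ← h1, sum_const, smul_eq_mul, hV] at h2
    exact lt_irrefl _ h2
  refine ⟨c, fun l h0 => ?_, _, fun t ht l => congrFun (mem_filter.1 ht).2 l, hU ▸ hc⟩
  have := Fintype.mem_piFinset.1 hcV l
  simp [h0] at this

lemma exNum_template_ge (hK : 9 ≤ K) (hr : r * 18 < 2 ^ k)
    (hQ : ∀ n : ℤ, n ≠ 0 → n.natAbs ≤ 10 ^ 9 → IsUnit (n : ZMod Q))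
    (hL : ∀ n : ℤ, n ≠ 0 → n.natAbs ≤ 10 ^ 9 → IsUnit (n : ZMod L))
    (h1 : ∀ n : ℤ, n ≠ 0 → n.natAbs ≤ 10 ^ 9 → ¬ (11 : ℤ) ∣ n → quadraticChar (ZMod Q) n = 1)
    (h11 : quadraticChar (ZMod Q) ((11 : ℤ) : ZMod Q) = -1) :
    7 * (((K / 2 : ℕ) : ℝ) / K) * ((r : ℝ) / 2 ^ k) * (((Q : ℝ) - 1) / Q) ^ (k * 18) *
      ((Nat.card (Point K r) * (Q ^ (k * 18) * Nat.card (Choice (Block K r) → ZMod Q)) * L : ℕ) : ℝ)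
        ^ 2 ≤
      exNum 3 (Nat.card (Point K r) * (Q ^ (k * 18) * Nat.card (Choice (Block K r) → ZMod Q)) * L)
        6 4 := by
  obtain ⟨cod, hcod, hcod0⟩ := exists_code hr
  obtain ⟨c, hc, T, hT, hcard⟩ := exists_large_fiber (K := K) (r := r) (k := k) (Q := Q) (L := L)
  have main := exists_isFree_template hK hQ hL h1 h11 hcod hcod0 hc T hT
  set C := Nat.card (Choice (Block K r) → ZMod Q)
  have hP : Nat.card (Point K r) = K * Nat.card (Label K r) := by
    rw [Nat.card_prod, Nat.card_zmod]
  have hB : Nat.card (Block K r) = K * (K / 2 * r) * (Nat.card (Label K r) ^ 2) := by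
    simp only [Nat.card_prod, Nat.card_zmod, Nat.card_fin, sq]
  have hR : Nat.card (Offset K r k Q L) = Q ^ (k * 18) * C * L := by
    rw [Nat.card_prod, Nat.card_prod, Nat.card_zmod, Nat.card_fun, Nat.card_zmod, Nat.card_prod,
      Nat.card_fin, Nat.card_fin, mul_assoc]
  have hn : Nat.card (Point K r) * (Q ^ (k * 18) * C) * L =
      Nat.card (Point K r) * Nat.card (Offset K r k Q L) := by rw [hR]; ring
  rw [hn]
  refine le_trans ?_ (Nat.cast_le.2 main)
  rw [hR, hP, hB]
  have hK0 : (0 : ℝ) < K := by exact_mod_cast (by omega : 0 < K)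
  have hQ1 : 1 ≤ Q := (Fact.out : Q.Prime).one_le
  have hQ0 : (0 : ℝ) < Q := by exact_mod_cast hQ1
  have hcard' : ((Q : ℝ) - 1) ^ (k * 18) * (C * L) ≤ 2 ^ k * T.card := by
    have := (Nat.cast_le (α := ℝ)).2 hcard
    push_cast [hQ1] at this
    exact this
  push_cast
  generalize (Nat.card (Label K r) : ℝ) = Λ
  have h2 : (0 : ℝ) < 2 ^ k := by positivity
  have e1 : 7 * (((K / 2 : ℕ) : ℝ) / K) * ((r : ℝ) / 2 ^ k) * (((Q : ℝ) - 1) / Q) ^ (k * 18) *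
      (K * Λ * (Q ^ (k * 18) * C * L)) ^ 2 = (7 * (K / 2 : ℕ) * K * r * Λ ^ 2 * Q ^ (k * 18) * C * L) *
        (((Q : ℝ) - 1) ^ (k * 18) * (C * L) / 2 ^ k) := by
    rw [div_pow]
    field_simp
  have e2 : 7 * ((K : ℝ) * ((K / 2 : ℕ) * r) * Λ ^ 2 * (Q ^ (k * 18) * C * L * T.card)) =
      (7 * (K / 2 : ℕ) * K * r * Λ ^ 2 * Q ^ (k * 18) * C * L) * T.card := by ring
  rw [e1, e2]
  refine mul_le_mul_of_nonneg_left ?_ (by positivity)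
  rw [div_le_iff₀ h2]
  linarith

end Count

open scoped Topology in
lemma tendsto_half_div : Tendsto (fun K : ℕ => ((K / 2 : ℕ) : ℝ) / K) atTop (𝓝 (1 / 2)) := by
  have h := tendsto_nat_floor_mul_div_atTop (R := ℝ) (a := 1 / 2) (by norm_num)
  refine (h.comp tendsto_natCast_atTop_atTop).congr fun K => ?_
  have : ⌊(1 / 2 : ℝ) * K⌋₊ = K / 2 := by
    rw [one_div_mul_eq_div, ← Nat.cast_ofNat, Nat.floor_div_natCast, Nat.floor_natCast]
  simp only [Function.comp_apply, this]

open scoped Topology in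
lemma tendsto_code_size : Tendsto (fun k : ℕ => (((2 ^ k - 1) / 18 : ℕ) : ℝ) / 2 ^ k) atTop
    (𝓝 (1 / 18)) := by
  have h2 : Tendsto (fun k : ℕ => (1 / 2 : ℝ) ^ k) atTop (𝓝 0) :=
    tendsto_pow_atTop_nhds_zero_of_lt_one (by norm_num) (by norm_num)
  have h3 : Tendsto (fun k : ℕ => (1 / 18 : ℝ) - (1 / 2 : ℝ) ^ k) atTop (𝓝 (1 / 18)) := by
    simpa using h2.const_sub (1 / 18 : ℝ)
  refine tendsto_of_tendsto_of_tendsto_of_le_of_le h3 tendsto_const_nhds (fun k => ?_) fun k => ?_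
  · have h : 2 ^ k ≤ (2 ^ k - 1) / 18 * 18 + 18 := by omega
    have h' : (2 : ℝ) ^ k ≤ ((2 ^ k - 1) / 18 : ℕ) * 18 + 18 := by exact_mod_cast h
    have hp : (0 : ℝ) < 2 ^ k := by positivity
    simp only [one_div_pow]
    rw [le_div_iff₀ hp, sub_mul, one_div_mul_cancel hp.ne']
    linarith
  · have h : (2 ^ k - 1) / 18 * 18 ≤ 2 ^ k := (Nat.div_mul_le_self _ _).trans (Nat.sub_le _ _)
    have h' : (((2 ^ k - 1) / 18 : ℕ) : ℝ) * 18 ≤ 2 ^ k := by exact_mod_cast h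
    have hp : (0 : ℝ) < 2 ^ k := by positivity
    simp only
    rw [div_le_iff₀ hp]
    linarith

open scoped Topology in
lemma tendsto_sub_one_div_pow (m : ℕ) :
    Tendsto (fun Q : ℕ => (((Q : ℝ) - 1) / Q) ^ m) atTop (𝓝 1) := by
  have h : Tendsto (fun Q : ℕ => (1 : ℝ) - 1 / Q) atTop (𝓝 1) := by
    simpa using tendsto_one_div_atTop_nhds_zero_nat.const_sub (1 : ℝ)
  have h' : Tendsto (fun Q : ℕ => ((Q : ℝ) - 1) / Q) atTop (𝓝 1) := by
    refine h.congr' ?_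
    filter_upwards [eventually_gt_atTop 0] with Q hQ
    rw [sub_div, div_self (by exact_mod_cast hQ.ne')]
  simpa using h'.pow m

lemma exists_progression {c : ℝ} (hc : c < 7 / 36) : ∃ N > 0, ∃ M > 0, ∀ j : ℕ,
    c * ((N * (1 + M * j) : ℕ) : ℝ) ^ 2 ≤ exNum 3 (N * (1 + M * j)) 6 4 := by
  obtain ⟨K, k, hK, hK9, hKk⟩ : ∃ K k : ℕ, K.Prime ∧ 9 ≤ K ∧
      c < 7 * (((K / 2 : ℕ) : ℝ) / K) * ((((2 ^ k - 1) / 18 : ℕ) : ℝ) / 2 ^ k) := by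
    have h := (((tendsto_half_div.comp tendsto_fst).const_mul 7).mul
      (tendsto_code_size.comp tendsto_snd)).eventually_const_lt
      (by linarith : c < 7 * (1 / 2) * (1 / 18))
    obtain ⟨K₀, hK₀⟩ := eventually_atTop.1 h.curry
    obtain ⟨K, hK, hp⟩ := Nat.exists_infinite_primes (max K₀ 9)
    obtain ⟨k, hk⟩ := (hK₀ K (le_of_max_le_left hK)).exists
    exact ⟨K, k, hp, le_of_max_le_right hK, hk⟩
  set r := (2 ^ k - 1) / 18 with hr
  have hr18 : r * 18 < 2 ^ k := by
    have := Nat.two_pow_pos k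
    omega
  obtain ⟨Q₀, hQ₀⟩ := eventually_atTop.1
    (((tendsto_sub_one_div_pow (k * 18)).const_mul
      (7 * (((K / 2 : ℕ) : ℝ) / K) * ((r : ℝ) / 2 ^ k))).eventually_const_lt (by rwa [mul_one]))
  obtain ⟨Q, hQ, hQ₀Q, h1, h11⟩ := exists_prime_quadraticChar (10 ^ 9) (max Q₀ (10 ^ 9))
  obtain ⟨M, hM, hMu⟩ := exists_modulus (10 ^ 9)
  have := Fact.mk hK
  refine ⟨Nat.card (Point K r) * (Q ^ (k * 18) * Nat.card (Choice (Block K r) → ZMod Q)), ?_, M, hM,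
    fun j => ?_⟩
  · exact Nat.mul_pos Nat.card_pos (Nat.mul_pos (pow_pos hQ.out.pos _) Nat.card_pos)
  · have : NeZero (1 + M * j) := ⟨by omega⟩
    have hL := hMu (1 + M * j) (by simp [Nat.ModEq])
    have hQu : ∀ n : ℤ, n ≠ 0 → n.natAbs ≤ 10 ^ 9 → IsUnit (n : ZMod Q) := fun n hn hnB =>
      isUnit_zmod_of_lt ((le_max_right _ _).trans_lt hQ₀Q) hn hnB
    refine le_trans ?_ (exNum_template_ge hK9 hr18 hQu hL h1 h11)
    exact mul_le_mul_of_nonneg_right (hQ₀ Q ((le_max_left _ _).trans hQ₀Q.le)).le (sq_nonneg _)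

lemma eventually_le_exNum_div {c : ℝ} (hc : c < 7 / 36) :
    ∀ᶠ n : ℕ in atTop, c ≤ (exNum 3 n 6 4 : ℝ) / (n : ℝ) ^ 2 := by
  rcases le_or_gt c 0 with h0 | h0
  · exact Eventually.of_forall fun n => h0.trans (by positivity)
  obtain ⟨d, hcd, hd⟩ := exists_between hc
  obtain ⟨N, hN, M, hM, h⟩ := exists_progression hd
  have hd0 : 0 < d := h0.trans hcd
  have hlim := (((tendsto_const_div_atTop_nhds_zero_nat ((N * (1 + M) : ℕ) : ℝ)).const_sub 1).pow
    2).const_mul d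
  rw [sub_zero, one_pow, mul_one] at hlim
  filter_upwards [hlim.eventually_const_lt hcd, eventually_ge_atTop (N * (1 + M))] with n hn hNn
  have hn0 : (0 : ℝ) < n := by
    have : 0 < N * (1 + M) := by positivity
    exact_mod_cast this.trans_le hNn
  obtain ⟨m, hm, hmn, hnm⟩ : ∃ j : ℕ, N ≤ n ∧ N * (1 + M * j) ≤ n ∧
      n ≤ N * (1 + M * j) + N * (1 + M) := by
    refine ⟨(n / N - 1) / M, ?_, ?_, ?_⟩
    · exact (Nat.le_mul_of_pos_right N (by omega)).trans hNn
    · have h1 : 1 ≤ n / N := by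
        rw [Nat.one_le_div_iff hN]
        exact (Nat.le_mul_of_pos_right N (by omega)).trans hNn
      have h2 := Nat.mul_div_le (n / N - 1) M
      calc N * (1 + M * ((n / N - 1) / M)) ≤ N * (n / N) := Nat.mul_le_mul_left N (by omega)
        _ ≤ n := Nat.mul_div_le n N
    · have h2 := Nat.lt_mul_div_succ (n / N - 1) hM
      have h3 := Nat.lt_mul_div_succ n hN
      have h4 : n / N + 1 ≤ (1 + M * ((n / N - 1) / M)) + (1 + M) := by
        rw [mul_add] at h2
        omega
      calc n ≤ N * (n / N + 1) := h3.le
        _ ≤ N * ((1 + M * ((n / N - 1) / M)) + (1 + M)) := Nat.mul_le_mul_left N h4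
        _ = _ := by ring
  have h5 : (n : ℝ) - (N * (1 + M) : ℕ) ≤ (N * (1 + M * m) : ℕ) := by
    rw [sub_le_iff_le_add]
    exact_mod_cast hnm
  have h6 : (0 : ℝ) ≤ (n : ℝ) - (N * (1 + M) : ℕ) := sub_nonneg.2 (by exact_mod_cast hNn)
  rw [le_div_iff₀ (by positivity)]
  calc c * (n : ℝ) ^ 2 ≤ d * (1 - (N * (1 + M) : ℕ) / (n : ℝ)) ^ 2 * (n : ℝ) ^ 2 :=
        mul_le_mul_of_nonneg_right hn.le (sq_nonneg _)
    _ = d * ((n : ℝ) - (N * (1 + M) : ℕ)) ^ 2 := by field_simp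
    _ ≤ d * ((N * (1 + M * m) : ℕ) : ℝ) ^ 2 := by gcongr
    _ ≤ exNum 3 (N * (1 + M * m)) 6 4 := h m
    _ ≤ exNum 3 n 6 4 := by exact_mod_cast exNum_mono 3 6 4 hmn

end BES64

/-- The liminf of `n⁻² f⁽³⁾(n; 6, 4)` is at least `7/36`. -/
theorem bes_64_lower :
    7 / 36 ≤ atTop.liminf (fun n : ℕ => (exNum 3 n 6 4 : ℝ) / (n : ℝ) ^ 2) := by
  have hbdd : IsBoundedUnder (· ≤ ·) atTop (fun n : ℕ => (exNum 3 n 6 4 : ℝ) / (n : ℝ) ^ 2) := by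
    refine isBoundedUnder_of ⟨3, fun n => div_le_of_le_mul₀ (sq_nonneg _) (by norm_num) ?_⟩
    exact_mod_cast BES64.exNum_le n
  exact le_of_forall_lt fun c hc => by
    obtain ⟨d, hcd, hd⟩ := exists_between hc
    exact hcd.trans_le (le_liminf_of_le hbdd.isCoboundedUnder_ge
      (BES64.eventually_le_exNum_div hd))
end

section
/- The limsup over n of n^{-2} f^{(3)}(n; 6, 4) is at most 7/36. -/
open Finset Filter

section FourEdges

variable {V : Type*} [DecidableEq V]

/-- Four distinct edges of a `(6,4)`-free hypergraph span at least seven vertices. -/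
theorem IsFree.seven_le_card {H : Finset (Finset V)} (hH : IsFree H 6 4) {a b c d : Finset V}
    (ha : a ∈ H) (hb : b ∈ H) (hc : c ∈ H) (hd : d ∈ H) (hab : a ≠ b) (hac : a ≠ c)
    (had : a ≠ d) (hbc : b ≠ c) (hbd : b ≠ d) (hcd : c ≠ d) {S : Finset V}
    (haS : a ⊆ S) (hbS : b ⊆ S) (hcS : c ⊆ S) (hdS : d ⊆ S) : 7 ≤ #S := by
  by_contra! hlt
  refine hH ⟨{a, b, c, d}, ?_, ?_, ?_⟩
  · simp [insert_subset_iff, *]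
  · simp [*]
  · refine (card_le_card (?_ : _ ⊆ S)).trans (by omega)
    rw [Finset.sup_le_iff]
    simp [*]

/-- The number of edges of `H` containing `p`. -/
def codegree (H : Finset (Finset V)) (p : Finset V) : ℕ := #{e ∈ H | p ⊆ e}

/-- The edges of `H` meeting `e` in exactly two vertices. -/
def friends (H : Finset (Finset V)) (e : Finset V) : Finset (Finset V) := {f ∈ H | #(e ∩ f) = 2}

/-- `e` claims `p` if `e` and `symmDiff e p` are two edges sharing a pair of vertices whose
remaining vertices form `p`. -/
def Claims (H : Finset (Finset V)) (e p : Finset V) : Prop := #(e ∩ p) = 1 ∧ symmDiff e p ∈ H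

instance (H : Finset (Finset V)) (e p : Finset V) : Decidable (Claims H e p) :=
  inferInstanceAs (Decidable (_ ∧ _))

/-- The share of the pair `p` that is assigned to the edge `e`; a pair has total share `14`. -/
def share (H : Finset (Finset V)) (e p : Finset V) : ℕ :=
  if p ⊆ e then if friends H e = ∅ then 12 else 14 / codegree H p
  else if Claims H e p then if codegree H p = 0 then 7 else 1
  else 0

theorem symmDiff_subset_union (e p : Finset V) : symmDiff e p ⊆ e ∪ p := by
  intro x; simp only [mem_union, mem_symmDiff]; tauto

theorem card_union_add_card_inter' {e f : Finset V} {a b c : ℕ} (he : #e = a) (hf : #f = b)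
    (hef : #(e ∩ f) = c) : #(e ∪ f) + c = a + b := by
  have := card_union_add_card_inter e f
  omega

theorem card_inter_symmDiff {e f : Finset V} (he : #e = 3) (hef : #(e ∩ f) = 2) :
    #(e ∩ symmDiff e f) = 1 := by
  have h1 : e ∩ symmDiff e f = e \ f := by
    ext x; simp only [mem_inter, mem_symmDiff, Finset.mem_sdiff]; tauto
  have h2 := card_sdiff_add_card_inter e f
  rw [h1]; omega

theorem card_symmDiff_eq_two {e f : Finset V} (he : #e = 3) (hf : #f = 3) (hef : #(e ∩ f) = 2) :
    #(symmDiff e f) = 2 := by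
  have h1 := card_sdiff_add_card_inter e f
  have h2 := card_sdiff_add_card_inter f e
  rw [inter_comm] at h2
  have h3 : #(symmDiff e f) = #(e \ f) + #(f \ e) := by
    rw [symmDiff_def, sup_eq_union, card_union_of_disjoint disjoint_sdiff_sdiff]
  omega

theorem Claims.not_subset {H : Finset (Finset V)} {e p : Finset V} (hp : #p = 2)
    (h : Claims H e p) : ¬ p ⊆ e := by
  intro hpe
  have := h.1
  rw [inter_eq_right.2 hpe] at this
  omega

theorem card_symmDiff_inter {e p : Finset V} (hp : #p = 2) (h : #(e ∩ p) = 1) :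
    #(symmDiff e p ∩ p) = 1 := by
  have h1 : symmDiff e p ∩ p = p \ e := by
    ext x; simp only [mem_inter, mem_symmDiff, Finset.mem_sdiff]; tauto
  have h2 := card_sdiff_add_card_inter p e
  rw [inter_comm] at h2
  rw [h1]; omega

theorem symmDiff_ne_self {e p : Finset V} (hp : #p = 2) : symmDiff e p ≠ e := by
  intro h
  rw [symmDiff_eq_left] at h
  simp [h] at hp

theorem Claims.symmDiff {H : Finset (Finset V)} {e p : Finset V} (he : e ∈ H) (hp : #p = 2)
    (h : Claims H e p) : Claims H (symmDiff e p) p :=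
  ⟨card_symmDiff_inter hp h.1, by rwa [symmDiff_symmDiff_cancel_right]⟩

variable {H : Finset (Finset V)}

theorem card_inter_le_two (h3 : ∀ e ∈ H, #e = 3)
    {e f : Finset V} (he : e ∈ H) (hf : f ∈ H) (hef : e ≠ f) :
    #(e ∩ f) ≤ 2 := by
  by_contra! h
  have h1 : e ∩ f = e := eq_of_subset_of_card_le inter_subset_left (by rw [h3 e he]; omega)
  have h2 : e ∩ f = f := eq_of_subset_of_card_le inter_subset_right (by rw [h3 f hf]; omega)
  exact hef (h1.symm.trans h2)

theorem card_claims_le_two (h3 : ∀ e ∈ H, #e = 3) (hH : IsFree H 6 4)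
    {p : Finset V} (hp : #p = 2) : #{e ∈ H | Claims H e p} ≤ 2 := by
  obtain h | ⟨a, ha⟩ := ({e ∈ H | Claims H e p}).eq_empty_or_nonempty
  · simp [h]
  refine (card_le_card (t := {a, symmDiff a p}) ?_).trans card_le_two
  intro b hb
  by_contra hne
  simp only [mem_filter, mem_insert, mem_singleton, not_or] at ha hb hne
  obtain ⟨haH, ha⟩ := ha
  obtain ⟨hbH, hb⟩ := hb
  obtain ⟨hne1, hne2⟩ := hne
  have hU := card_union_add_card_inter' (h3 a haH) hp ha.1
  have hb' := card_sdiff_add_card_inter b p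
  have hb1 := hb.1
  have hb3 := h3 b hbH
  have hsub : b ⊆ (a ∪ p) ∪ (b \ p) := by
    intro x; simp only [mem_union, Finset.mem_sdiff]; tauto
  have h7 := hH.seven_le_card (S := (a ∪ p) ∪ (b \ p)) haH ha.2 hbH hb.2
    (symmDiff_ne_self hp).symm (Ne.symm hne1)
    (fun h => hne2 (by rw [h, symmDiff_symmDiff_cancel_right])) (Ne.symm hne2)
    (fun h => hne1 (symmDiff_left_injective p h).symm) (symmDiff_ne_self hp).symm
    (subset_union_left.trans subset_union_left)
    ((symmDiff_subset_union a p).trans subset_union_left) hsub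
    ((symmDiff_subset_union b p).trans (union_subset hsub
      (subset_union_right.trans subset_union_left)))
  have := card_union_le (a ∪ p) (b \ p)
  omega

theorem claims_not_mem_friends (h3 : ∀ e ∈ H, #e = 3)
    (hK : ∀ e ∈ H, ∀ f ∈ H, ∀ g ∈ H, e ≠ f → e ≠ g → f ≠ g → 5 ≤ #(e ∪ f ∪ g))
    {a g p : Finset V} (hp : #p = 2) (ha : a ∈ H) (hap : Claims H a p)
    (hg : g ∈ H) (hpg : p ⊆ g) : a ∉ friends H g := by
  intro h
  have h2 := (mem_filter.1 h).2
  have hsub : a ∪ symmDiff a p ∪ g ⊆ g ∪ a :=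
    union_subset (union_subset subset_union_right ((symmDiff_subset_union a p).trans
      (union_subset subset_union_right (hpg.trans subset_union_left)))) subset_union_left
  have h5 := hK a ha _ hap.2 g hg (symmDiff_ne_self hp).symm
    (fun h => hap.not_subset hp (h ▸ hpg))
    (fun h => (hap.symmDiff ha hp).not_subset hp (h ▸ hpg))
  have := card_le_card hsub
  have := card_union_add_card_inter' (h3 g hg) (h3 a ha) h2
  omega

theorem friends_eq_empty_of_claims (h3 : ∀ e ∈ H, #e = 3) (hH : IsFree H 6 4)
    (hK : ∀ e ∈ H, ∀ f ∈ H, ∀ g ∈ H, e ≠ f → e ≠ g → f ≠ g → 5 ≤ #(e ∪ f ∪ g))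
    {a g p : Finset V} (hp : #p = 2) (ha : a ∈ H)
    (hap : Claims H a p) (hg : g ∈ H) (hpg : p ⊆ g) : friends H g = ∅ := by
  by_contra! hne
  obtain ⟨h, hh⟩ := hne
  have hap' := hap.symmDiff ha hp
  have hha : a ≠ h := by
    rintro rfl; exact claims_not_mem_friends h3 hK hp ha hap hg hpg hh
  have hha' : symmDiff a p ≠ h := by
    rintro rfl; exact claims_not_mem_friends h3 hK hp hap.2 hap' hg hpg hh
  obtain ⟨hhH, hh⟩ := mem_filter.1 hh
  have hgh : g ≠ h := by
    rintro rfl; rw [inter_self, h3 g hg] at hh; omega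
  have h7 := hH.seven_le_card (S := (a \ p) ∪ (g ∪ h)) ha hap.2 hg hhH (symmDiff_ne_self hp).symm
    (fun h => hap.not_subset hp (h ▸ hpg)) hha
    (fun h => hap'.not_subset hp (h ▸ hpg)) hha' hgh
    (fun x hx => by have := @hpg x; simp only [mem_union, Finset.mem_sdiff]; tauto)
    (fun x hx => by
      have := @hpg x
      simp only [mem_union, Finset.mem_sdiff, mem_symmDiff] at hx ⊢; tauto)
    (subset_union_left.trans subset_union_right) (subset_union_right.trans subset_union_right)
  have h1 := card_union_add_card_inter' (h3 g hg) (h3 h hhH) hh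
  have h2 := card_sdiff_add_card_inter a p
  have h4 := h3 a ha
  have h5 := hap.1
  have := card_union_le (a \ p) (g ∪ h)
  omega

theorem codegree_eq_one (h3 : ∀ e ∈ H, #e = 3)
    {p g : Finset V} (hp : #p = 2) (hg : g ∈ H) (hpg : p ⊆ g)
    (hf : friends H g = ∅) : codegree H p = 1 := by
  rw [codegree, card_eq_one]
  refine ⟨g, eq_singleton_iff_unique_mem.2 ⟨by simp [hg, hpg], fun f hfp => ?_⟩⟩
  obtain ⟨hfH, hpf⟩ := mem_filter.1 hfp
  by_contra hne
  have h1 := card_inter_le_two h3 hg hfH (Ne.symm hne)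
  have h2 := card_le_card (subset_inter hpg hpf)
  have : f ∈ friends H g := mem_filter.2 ⟨hfH, by omega⟩
  simp [hf] at this

/-- The shares of a pair sum to at most `14`. -/
theorem sum_share_le (h3 : ∀ e ∈ H, #e = 3) (hH : IsFree H 6 4)
    (hK : ∀ e ∈ H, ∀ f ∈ H, ∀ g ∈ H, e ≠ f → e ≠ g → f ≠ g → 5 ≤ #(e ∪ f ∪ g))
    {p : Finset V} (hp : #p = 2) : ∑ e ∈ H, share H e p ≤ 14 := by
  have hsplit : ∑ e ∈ H, share H e p = ∑ e ∈ H with p ⊆ e, share H e p +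
      ∑ e ∈ H with Claims H e p, share H e p := by
    rw [sum_filter, sum_filter, ← sum_add_distrib]
    refine sum_congr rfl fun e _ => ?_
    by_cases h1 : p ⊆ e
    · have h2 : ¬ Claims H e p := fun h => h.not_subset hp h1
      simp [h1, h2]
    · by_cases h2 : Claims H e p <;> simp [share, h1, h2]
  have hC := card_claims_le_two h3 hH hp
  rw [hsplit]
  by_cases h0 : codegree H p = 0
  · have hD : ({e ∈ H | p ⊆ e} : Finset _) = ∅ := by simpa [codegree] using h0
    rw [hD, sum_empty, zero_add]
    refine (sum_le_card_nsmul _ _ 7 fun e he => ?_).trans (by rw [smul_eq_mul]; omega)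
    have he' := (mem_filter.1 he).2
    simp [share, h0, he', he'.not_subset hp]
  have hCs : ∑ e ∈ H with Claims H e p, share H e p ≤ #{e ∈ H | Claims H e p} := by
    refine (sum_le_card_nsmul _ _ 1 fun e he => ?_).trans (by simp)
    have he' := (mem_filter.1 he).2
    simp [share, h0, he', he'.not_subset hp]
  obtain hCe | ⟨a, ha⟩ := ({e ∈ H | Claims H e p}).eq_empty_or_nonempty
  · rw [hCe, sum_empty, add_zero]
    refine (sum_le_card_nsmul _ _ (14 / codegree H p) fun e he => ?_).trans ?_
    · obtain ⟨heH, hpe⟩ := mem_filter.1 he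
      by_cases hf : friends H e = ∅
      · simp [share, hpe, hf, codegree_eq_one h3 hp heH hpe hf]
      · simp [share, hpe, hf]
    · exact Nat.mul_div_le 14 (codegree H p)
  · obtain ⟨haH, ha⟩ := mem_filter.1 ha
    have hemp : ∀ e ∈ H, p ⊆ e → friends H e = ∅ := fun e he hpe =>
      friends_eq_empty_of_claims h3 hH hK hp haH ha he hpe
    have h1 : #{e ∈ H | p ⊆ e} = 1 := by
      obtain ⟨g, hg⟩ := card_pos.1 (Nat.pos_of_ne_zero h0)
      obtain ⟨hgH, hpg⟩ := mem_filter.1 hg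
      exact codegree_eq_one h3 hp hgH hpg (hemp g hgH hpg)
    have h2 : ∑ e ∈ H with p ⊆ e, share H e p ≤ #{e ∈ H | p ⊆ e} • 12 := by
      refine sum_le_card_nsmul _ _ 12 fun e he => ?_
      obtain ⟨heH, hpe⟩ := mem_filter.1 he
      simp [share, hpe, hemp e heH hpe]
    rw [h1, one_smul] at h2
    omega

theorem card_friends_le_two (h3 : ∀ e ∈ H, #e = 3) (hH : IsFree H 6 4)
    {e : Finset V} (he : e ∈ H) : #(friends H e) ≤ 2 := by
  by_contra! h
  obtain ⟨f, g, k, hf, hg, hk, hfg, hfk, hgk⟩ := two_lt_card_iff.1 h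
  have key : ∀ x ∈ friends H e, x ∈ H ∧ e ≠ x ∧ #(x \ e) = 1 := by
    intro x hx
    obtain ⟨hxH, hx⟩ := mem_filter.1 hx
    refine ⟨hxH, ?_, ?_⟩
    · rintro rfl
      rw [inter_self, h3 e he] at hx; omega
    · have h1 := card_sdiff_add_card_inter x e
      rw [inter_comm, hx, h3 x hxH] at h1; omega
  obtain ⟨hfH, hef, hf1⟩ := key f hf
  obtain ⟨hgH, heg, hg1⟩ := key g hg
  obtain ⟨hkH, hek, hk1⟩ := key k hk
  have h7 := hH.seven_le_card (S := e ∪ f \ e ∪ g \ e ∪ k \ e) he hfH hgH hkH hef heg hek hfg hfk hgk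
    (fun x hx => by simp [hx]) (fun x hx => by simp [hx]) (fun x hx => by simp [hx]; tauto)
    (fun x hx => by simp [hx]; tauto)
  have h4 := card_union_le (e ∪ f \ e ∪ g \ e) (k \ e)
  have h5 := card_union_le (e ∪ f \ e) (g \ e)
  have h6 := card_union_le e (f \ e)
  have := h3 e he
  omega

theorem codegree_symmDiff_eq_zero (h3 : ∀ e ∈ H, #e = 3) (hH : IsFree H 6 4)
    (hK : ∀ e ∈ H, ∀ f ∈ H, ∀ g ∈ H, e ≠ f → e ≠ g → f ≠ g → 5 ≤ #(e ∪ f ∪ g))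
    {e f g : Finset V} (he : e ∈ H) (hf : f ∈ friends H e)
    (hg : g ∈ friends H e) (hfg : f ≠ g) : codegree H (symmDiff e f) = 0 := by
  obtain ⟨hfH, hf⟩ := mem_filter.1 hf
  obtain ⟨hgH, hg⟩ := mem_filter.1 hg
  have he3 := h3 e he
  have hf3 := h3 f hfH
  have hg3 := h3 g hgH
  have hef : e ≠ f := by rintro rfl; rw [inter_self] at hf; omega
  have heg : e ≠ g := by rintro rfl; rw [inter_self] at hg; omega
  rw [codegree, card_eq_zero, filter_eq_empty_iff]
  intro k hk hsub
  have hp := card_symmDiff_eq_two he3 hf3 hf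
  have hke : e ≠ k := by
    rintro rfl
    have h1 := card_inter_symmDiff he3 hf
    rw [inter_eq_right.2 hsub] at h1; omega
  have hkf : f ≠ k := by
    rintro rfl
    have h1 := card_inter_symmDiff hf3 (inter_comm e f ▸ hf)
    rw [symmDiff_comm f e, inter_eq_right.2 hsub] at h1; omega
  have hU := card_union_add_card_inter' he3 hf3 hf
  by_cases hkg : g = k
  · subst hkg
    have h5 := hK e he f hfH g hgH hef heg hfg
    have hs : e ∪ f ∪ g ⊆ e ∪ g := by
      intro x
      have := @hsub x
      simp only [mem_union, mem_symmDiff] at this ⊢; tauto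
    have := card_le_card hs
    have := card_union_add_card_inter' he3 hg3 hg
    omega
  · have h7 := hH.seven_le_card (S := e ∪ f ∪ g \ e ∪ k \ symmDiff e f) he hfH hgH hk
      hef heg hke hfg hkf hkg
      (fun x hx => by simp [hx]) (fun x hx => by simp [hx])
      (fun x hx => by simp [hx]; tauto)
      (fun x hx => by simp only [mem_union, Finset.mem_sdiff, mem_symmDiff]; tauto)
    have h1 := card_union_le (e ∪ f ∪ g \ e) (k \ symmDiff e f)
    have h2 := card_union_le (e ∪ f) (g \ e)
    have h4 := card_sdiff_add_card_inter g e
    rw [inter_comm] at h4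
    have h5 := card_sdiff_add_card_inter k (symmDiff e f)
    rw [inter_eq_right.2 hsub] at h5
    have := h3 k hk
    omega

theorem sum_codegree (h3 : ∀ e ∈ H, #e = 3)
    {e : Finset V} (he : e ∈ H) :
    ∑ p ∈ powersetCard 2 e, codegree H p = 3 + #(friends H e) := by
  have he3 := h3 e he
  have h1 : ∑ p ∈ powersetCard 2 e, codegree H p = ∑ f ∈ H, (#(e ∩ f)).choose 2 := by
    simp only [codegree, card_filter]
    rw [sum_comm]
    refine sum_congr rfl fun f _ => ?_
    rw [← card_filter, ← card_powersetCard]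
    congr 1
    ext p
    simp only [mem_filter, mem_powersetCard, subset_inter_iff]
    tauto
  have h2 : friends H e = {f ∈ H.erase e | #(e ∩ f) = 2} := by
    ext f
    simp only [friends, mem_filter, mem_erase]
    refine ⟨fun h => ⟨⟨?_, h.1⟩, h.2⟩, fun h => ⟨h.1.2, h.2⟩⟩
    rintro rfl
    have := h.2
    rw [inter_self] at this; omega
  rw [h1, ← add_sum_erase _ _ he, inter_self, he3, h2, card_filter]
  congr 1
  refine sum_congr rfl fun f hf => ?_
  obtain ⟨hne, hf⟩ := mem_erase.1 hf
  have := card_inter_le_two h3 he hf (Ne.symm hne)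
  interval_cases #(e ∩ f) <;> rfl

/-- Every edge receives a total share of at least `36`. -/
theorem le_sum_share (h3 : ∀ e ∈ H, #e = 3) (hH : IsFree H 6 4)
    (hK : ∀ e ∈ H, ∀ f ∈ H, ∀ g ∈ H, e ≠ f → e ≠ g → f ≠ g → 5 ≤ #(e ∪ f ∪ g))
    [Fintype V] {e : Finset V} (he : e ∈ H) :
    36 ≤ ∑ p ∈ powersetCard 2 univ, share H e p := by
  have he3 := h3 e he
  have key : ∀ f ∈ friends H e, #(symmDiff e f) = 2 ∧ Claims H e (symmDiff e f) := by
    intro f hf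
    obtain ⟨hfH, hf⟩ := mem_filter.1 hf
    exact ⟨card_symmDiff_eq_two he3 (h3 f hfH) hf, card_inter_symmDiff he3 hf,
      by rwa [symmDiff_symmDiff_cancel_left]⟩
  have hsum : ∑ p ∈ powersetCard 2 e, share H e p +
      ∑ f ∈ friends H e, share H e (symmDiff e f) ≤
      ∑ p ∈ powersetCard 2 univ, share H e p := by
    rw [← sum_image (f := share H e) (g := symmDiff e)
      (fun f _ g _ h => symmDiff_right_injective e h), ← sum_union]
    · refine sum_le_sum_of_subset (union_subset (powersetCard_mono (subset_univ e)) ?_)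
      intro p hp
      obtain ⟨f, hf, rfl⟩ := mem_image.1 hp
      simp [mem_powersetCard, (key f hf).1]
    · rw [disjoint_right]
      intro p hp hpe
      obtain ⟨f, hf, rfl⟩ := mem_image.1 hp
      exact (key f hf).2.not_subset (key f hf).1 (mem_powersetCard.1 hpe).1
  have hcard : #(powersetCard 2 e) = 3 := by rw [card_powersetCard, he3]; rfl
  refine le_trans ?_ hsum
  by_cases hemp : friends H e = ∅
  · refine le_add_right ?_
    rw [sum_congr rfl (g := fun _ => 12)
      fun p hp => by simp [share, (mem_powersetCard.1 hp).1, hemp], sum_const, hcard]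
    rfl
  have hpairs : 63 ≤ ∑ p ∈ powersetCard 2 e, share H e p +
      7 * ∑ p ∈ powersetCard 2 e, codegree H p := by
    rw [mul_sum, ← sum_add_distrib]
    refine le_trans (by rw [hcard]; rfl) (card_nsmul_le_sum _ _ 21 fun p hp => ?_)
    have hpe := (mem_powersetCard.1 hp).1
    have hpos : 0 < codegree H p := card_pos.2 ⟨e, mem_filter.2 ⟨he, hpe⟩⟩
    simp only [share, hpe, hemp, if_true, if_false]
    by_cases h : codegree H p < 3
    · interval_cases codegree H p <;> norm_num
    · exact le_add_left (by omega)
  rw [sum_codegree h3 he] at hpairs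
  have hle := card_friends_le_two h3 hH he
  have hpos := card_pos.2 (nonempty_iff_ne_empty.2 hemp)
  obtain h1 | h2 : #(friends H e) = 1 ∨ #(friends H e) = 2 := by omega
  · have : #(friends H e) • 1 ≤ ∑ f ∈ friends H e, share H e (symmDiff e f) := by
      refine card_nsmul_le_sum _ _ 1 fun f hf => ?_
      obtain ⟨hp, hc⟩ := key f hf
      simp only [share, hc.not_subset hp, hc, if_true, if_false]
      split_ifs <;> norm_num
    rw [smul_eq_mul] at this
    omega
  · have : #(friends H e) • 7 ≤ ∑ f ∈ friends H e, share H e (symmDiff e f) := by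
      refine card_nsmul_le_sum _ _ 7 fun f hf => ?_
      obtain ⟨hp, hc⟩ := key f hf
      obtain ⟨g, hg, hgf⟩ := exists_mem_ne (s := friends H e) (by omega) f
      simp [share, hc.not_subset hp, hc, codegree_symmDiff_eq_zero h3 hH hK he hf hg hgf.symm]
    rw [smul_eq_mul] at this
    omega

theorem card_edges_le_of_no_three_on_four (h3 : ∀ e ∈ H, #e = 3) (hH : IsFree H 6 4)
    (hK : ∀ e ∈ H, ∀ f ∈ H, ∀ g ∈ H, e ≠ f → e ≠ g → f ≠ g → 5 ≤ #(e ∪ f ∪ g))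
    [Fintype V] : 36 * #H ≤ 7 * Fintype.card V ^ 2 := by
  have h1 : #H • 36 ≤ ∑ e ∈ H, ∑ p ∈ powersetCard 2 univ, share H e p :=
    card_nsmul_le_sum _ _ _ fun e he => le_sum_share h3 hH hK he
  rw [sum_comm] at h1
  have h2 : ∑ p ∈ powersetCard 2 univ, ∑ e ∈ H, share H e p ≤
      #(powersetCard 2 (univ : Finset V)) • 14 :=
    sum_le_card_nsmul _ _ _ fun p hp => sum_share_le h3 hH hK (mem_powersetCard.1 hp).2
  rw [card_powersetCard, card_univ, smul_eq_mul] at h2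
  rw [smul_eq_mul] at h1
  have h4 : (Fintype.card V).choose 2 * 2 ≤ Fintype.card V ^ 2 := by
    rw [Nat.choose_two_right, sq]
    exact (Nat.div_mul_le_self _ _).trans (Nat.mul_le_mul_left _ (Nat.sub_le _ _))
  omega

end FourEdges

/-- The number of edges of a `(6,4)`-free `3`-graph, up to a linear term. -/
theorem card_edges_le {V : Type*} [DecidableEq V] [Fintype V] {G : Finset (Finset V)}
    (h3 : ∀ e ∈ G, #e = 3) (hG : IsFree G 6 4) :
    36 * #G ≤ 7 * Fintype.card V ^ 2 + 108 * Fintype.card V := by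
  classical
  let bad : Finset V → Prop := fun e =>
    ∃ f ∈ G, ∃ g ∈ G, e ≠ f ∧ e ≠ g ∧ f ≠ g ∧ #(e ∪ f ∪ g) ≤ 4
  have hgood : 36 * #{e ∈ G | ¬ bad e} ≤ 7 * Fintype.card V ^ 2 := by
    refine card_edges_le_of_no_three_on_four (fun e he => h3 e (mem_filter.1 he).1) ?_ ?_
    · rintro ⟨S, hS, h⟩
      exact hG ⟨S, hS.trans (filter_subset _ _), h⟩
    · intro e he f hf g hg hef heg hfg
      by_contra! hlt
      exact (mem_filter.1 he).2
        ⟨f, (mem_filter.1 hf).1, g, (mem_filter.1 hg).1, hef, heg, hfg, by omega⟩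
  have hvert : ∀ e ∈ G, ∃ v, v ∈ e := fun e he => card_pos.1 (by rw [h3 e he]; norm_num)
  have hbad : #{e ∈ G | bad e} ≤ 3 * Fintype.card V := by
    have hdeg : ∀ v : V, #{e ∈ G | bad e ∧ v ∈ e} ≤ 3 := by
      intro v
      obtain h | ⟨e, he⟩ := ({e ∈ G | bad e ∧ v ∈ e}).eq_empty_or_nonempty
      · simp [h]
      obtain ⟨he, ⟨f, hf, g, hg, hef, heg, hfg, hS⟩, hv⟩ := mem_filter.1 he
      refine (card_le_card (t := {e, f, g}) ?_).trans card_le_three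
      intro k hk
      obtain ⟨hk, -, hvk⟩ := mem_filter.1 hk
      by_contra hne
      simp only [mem_insert, mem_singleton, not_or] at hne
      have h7 := hG.seven_le_card (S := e ∪ f ∪ g ∪ k) he hf hg hk hef heg (Ne.symm hne.1) hfg
        (Ne.symm hne.2.1) (Ne.symm hne.2.2) (fun x hx => by simp [hx]) (fun x hx => by simp [hx])
        (fun x hx => by simp [hx]) (fun x hx => by simp [hx])
      have h1 := card_union_add_card_inter (e ∪ f ∪ g) k
      have h2 : 0 < #((e ∪ f ∪ g) ∩ k) := card_pos.2 ⟨v, by simp [hv, hvk]⟩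
      have := h3 k hk
      omega
    calc #{e ∈ G | bad e} ≤ #(univ.biUnion fun v => {e ∈ G | bad e ∧ v ∈ e}) := by
          refine card_le_card fun e he => ?_
          obtain ⟨he, hb⟩ := mem_filter.1 he
          obtain ⟨v, hv⟩ := hvert e he
          exact mem_biUnion.2 ⟨v, mem_univ v, mem_filter.2 ⟨he, hb, hv⟩⟩
      _ ≤ #(univ : Finset V) * 3 := card_biUnion_le_card_mul _ _ _ fun v _ => hdeg v
      _ = 3 * Fintype.card V := by rw [card_univ, mul_comm]
  have : #{e ∈ G | bad e} + #{e ∈ G | ¬ bad e} = #G := card_filter_add_card_filter_not _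
  omega

theorem exNum_three_six_four_le (n : ℕ) : 36 * exNum 3 n 6 4 ≤ 7 * n ^ 2 + 108 * n := by
  have h : exNum 3 n 6 4 ≤ (7 * n ^ 2 + 108 * n) / 36 := by
    refine csSup_le' ?_
    rintro m ⟨G, h3, hG, rfl⟩
    have := card_edges_le h3 hG
    rw [Fintype.card_fin] at this
    omega
  omega

/-- The limsup of `n⁻² f⁽³⁾(n; 6, 4)` is at most `7/36`. -/
theorem bes_64_upper :
    atTop.limsup (fun n : ℕ => (exNum 3 n 6 4 : ℝ) / (n : ℝ) ^ 2) ≤ 7 / 36 := by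
  have hlim : Tendsto (fun n : ℕ => (7 / 36 : ℝ) + 3 / (n : ℝ)) atTop (nhds (7 / 36)) := by
    simpa using (tendsto_const_div_atTop_nhds_zero_nat (3 : ℝ)).const_add (7 / 36 : ℝ)
  rw [← hlim.limsup_eq]
  refine limsup_le_limsup ?_ ?_ hlim.isBoundedUnder_le
  · filter_upwards [eventually_gt_atTop 0] with n hn
    have hn' : (0 : ℝ) < n := by exact_mod_cast hn
    have h : (36 : ℝ) * exNum 3 n 6 4 ≤ 7 * n ^ 2 + 108 * n := by
      exact_mod_cast exNum_three_six_four_le n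
    rw [div_le_iff₀ (by positivity)]
    have : (7 / 36 + 3 / (n : ℝ)) * n ^ 2 = 7 / 36 * n ^ 2 + 3 * n := by field_simp
    rw [this]
    linarith
  · exact isCoboundedUnder_le_of_le atTop (x := 0) fun n => by positivity
end

section
/- Let r ≥ 3 and t be integers with 2 ≤ t ≤ r−1. There exists a constant C = C(r,t) such that for every n, every (4r−3t, 4)-free r-graph G on n vertices contains a spanning subgraph G' which is (3r−2t−1, 3)-free and (2r−t−1, 2)-free and has at least |G| − C·n^{t−1} edges. -/
open Finset Filter

theorem IsFree.mono {V : Type*} [DecidableEq V] {G H : Finset (Finset V)} {s k : ℕ}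
    (hG : IsFree G s k) (h : H ⊆ G) : IsFree H s k :=
  fun ⟨S, hS, hc⟩ => hG ⟨S, hS.trans h, hc⟩

/-- The edges of `G` lying in some `(s,k)`-configuration of `G`. -/
noncomputable def configurationEdges {V : Type*} [DecidableEq V] (G : Finset (Finset V))
    (s k : ℕ) : Finset (Finset V) :=
  open Classical in {e ∈ G | ∃ T ⊆ G, e ∈ T ∧ T.card = k ∧ (T.sup id).card ≤ s}

theorem mem_configurationEdges {V : Type*} [DecidableEq V] {G : Finset (Finset V)} {s k : ℕ}
    {e : Finset V} : e ∈ configurationEdges G s k ↔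
      e ∈ G ∧ ∃ T ⊆ G, e ∈ T ∧ T.card = k ∧ (T.sup id).card ≤ s := by
  simp [configurationEdges]

theorem isFree_sdiff_configurationEdges {V : Type*} [DecidableEq V] (G : Finset (Finset V))
    {s k : ℕ} (hk : 0 < k) : IsFree (G \ configurationEdges G s k) s k := by
  rintro ⟨S, hS, hc, hs⟩
  obtain ⟨e, he⟩ := Finset.card_pos.mp (hc ▸ hk)
  have hSG := hS.trans sdiff_subset
  exact (mem_sdiff.mp (hS he)).2 (mem_configurationEdges.mpr ⟨hSG he, S, hSG, he, hc, hs⟩)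

/-- If, for each edge `e` of `B`, all edges of `B` meeting `e` in at least `k` vertices lie in a
common family of at most `m` edges, then `B` has at most `m * n ^ k` edges. -/
theorem card_le_mul_pow_of_forall_exists_family {n : ℕ} {B : Finset (Finset (Fin n))} {m k : ℕ}
    (hk : ∀ e ∈ B, k ≤ e.card)
    (h : ∀ e ∈ B, ∃ T : Finset (Finset (Fin n)), T.card ≤ m ∧
      ∀ e' ∈ B, k ≤ (e ∩ e').card → e' ∈ T) :
    B.card ≤ m * n ^ k := by
  choose! φ hφ hφc using fun e he => exists_subset_card_eq (hk e he)
  have himage : (B.image φ).card ≤ n ^ k := by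
    have hsub : B.image φ ⊆ powersetCard k univ := by
      intro S hS
      obtain ⟨e, he, rfl⟩ := mem_image.mp hS
      exact mem_powersetCard.mpr ⟨subset_univ _, hφc e he⟩
    refine (card_le_card hsub).trans ?_
    rw [card_powersetCard, card_univ, Fintype.card_fin]
    exact Nat.choose_le_pow n k
  refine (card_le_mul_card_image B m ?_).trans (Nat.mul_le_mul_left m himage)
  intro S hS
  obtain ⟨e, he, rfl⟩ := mem_image.mp hS
  obtain ⟨T, hT, hmem⟩ := h e he
  refine (card_le_card fun e' he' => ?_).trans hT
  obtain ⟨he'B, heq⟩ := mem_filter.mp he'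
  refine hmem e' he'B ?_
  rw [← hφc e he]
  exact card_le_card (subset_inter (hφ e he) (heq ▸ hφ e' he'B))

theorem card_configurationEdges_three_le {n r t : ℕ} (htr : t + 1 ≤ r)
    {G : Finset (Finset (Fin n))} (hG : ∀ e ∈ G, e.card = r)
    (hfree : IsFree G (4 * r - 3 * t) 4) :
    (configurationEdges G (3 * r - 2 * t - 1) 3).card ≤ 3 * n ^ (t - 1) := by
  refine card_le_mul_pow_of_forall_exists_family (fun e he => ?_) fun e he => ?_
  · rw [hG e (mem_configurationEdges.mp he).1]; omega
  obtain ⟨-, T, hTG, heT, hT, hTs⟩ := mem_configurationEdges.mp he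
  refine ⟨T, hT.le, fun e' he' hinter => ?_⟩
  by_contra he'T
  have he'G := (mem_configurationEdges.mp he').1
  refine hfree ⟨insert e' T, insert_subset he'G hTG, by rw [card_insert_of_notMem he'T, hT], ?_⟩
  rw [sup_insert, id, sup_eq_union]
  have hunion := card_union_add_card_inter e' (T.sup id)
  have hsub : e ∩ e' ⊆ e' ∩ T.sup id :=
    subset_inter inter_subset_right (inter_subset_left.trans (le_sup (f := id) heT))
  have := card_le_card hsub
  have := hG e' he'G
  omega

theorem card_configurationEdges_two_le {n r t : ℕ} (htr : t + 1 ≤ r)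
    {G : Finset (Finset (Fin n))} (hG : ∀ e ∈ G, e.card = r)
    (hfree₄ : IsFree G (4 * r - 3 * t) 4) (hfree₃ : IsFree G (3 * r - 2 * t - 1) 3) :
    (configurationEdges G (2 * r - t - 1) 2).card ≤ 2 * n ^ (t - 1) := by
  refine card_le_mul_pow_of_forall_exists_family (fun e he => ?_) fun e he => ?_
  · rw [hG e (mem_configurationEdges.mp he).1]; omega
  obtain ⟨-, T, hTG, heT, hT, hTs⟩ := mem_configurationEdges.mp he
  refine ⟨T, hT.le, fun e' he' hinter => ?_⟩
  by_contra he'T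
  obtain ⟨-, T', hT'G, he'T', hT', hT's⟩ := mem_configurationEdges.mp he'
  have hunion := card_union_add_card_inter (T.sup id) (T'.sup id)
  have hedges := card_union_add_card_inter T T'
  have hsup : (T ∪ T').sup id = T.sup id ∪ T'.sup id := sup_union
  rcases (T ∩ T').eq_empty_or_nonempty with hempty | ⟨a, ha⟩
  · refine hfree₄ ⟨T ∪ T', union_subset hTG hT'G, by simp_all, ?_⟩
    have hsub : e ∩ e' ⊆ T.sup id ∩ T'.sup id :=
      inter_subset_inter (le_sup (f := id) heT) (le_sup (f := id) he'T')
    have := card_le_card hsub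
    rw [hsup]
    omega
  · obtain ⟨haT, haT'⟩ := mem_inter.mp ha
    have hpos : 0 < (T ∩ T').card := card_pos.mpr ⟨a, ha⟩
    have hlarge : (insert e' T).card ≤ (T ∪ T').card :=
      card_le_card (insert_subset (mem_union_right T he'T') subset_union_left)
    rw [card_insert_of_notMem he'T] at hlarge
    refine hfree₃ ⟨T ∪ T', union_subset hTG hT'G, by omega, ?_⟩
    have hsub : a ⊆ T.sup id ∩ T'.sup id :=
      subset_inter (le_sup (f := id) haT) (le_sup (f := id) haT')
    have := card_le_card hsub
    have := hG a (hTG haT)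
    rw [hsup]
    omega

/-- Lemma 9: every `(4r-3t, 4)`-free `r`-graph on `n` vertices contains a spanning subgraph
which is `(3r-2t-1, 3)`-free and `(2r-t-1, 2)`-free and has at least `|G| - C·n^{t-1}` edges. -/
theorem cleaning_lemma (r t : ℕ) (hr : 3 ≤ r) (ht : 2 ≤ t) (htr : t ≤ r - 1) :
    ∃ C : ℝ, ∀ n : ℕ, ∀ G : Finset (Finset (Fin n)),
      (∀ e ∈ G, e.card = r) → IsFree G (4 * r - 3 * t) 4 →
      ∃ G' ⊆ G, IsFree G' (3 * r - 2 * t - 1) 3 ∧ IsFree G' (2 * r - t - 1) 2 ∧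
        (G.card : ℝ) - C * (n : ℝ) ^ (t - 1) ≤ (G'.card : ℝ) := by
  refine ⟨5, fun n G hG hfree => ?_⟩
  have htr' : t + 1 ≤ r := by omega
  set H := G \ configurationEdges G (3 * r - 2 * t - 1) 3
  have hHG : H ⊆ G := sdiff_subset
  have hH : IsFree H (3 * r - 2 * t - 1) 3 := isFree_sdiff_configurationEdges G (by norm_num)
  have hthree := card_configurationEdges_three_le htr' hG hfree
  have htwo := card_configurationEdges_two_le htr' (fun e he => hG e (hHG he))
    (hfree.mono hHG) hH
  refine ⟨H \ configurationEdges H (2 * r - t - 1) 2, sdiff_subset.trans hHG,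
    hH.mono sdiff_subset, isFree_sdiff_configurationEdges H (by norm_num), ?_⟩
  have hcardH : G.card ≤ H.card + (configurationEdges G (3 * r - 2 * t - 1) 3).card :=
    card_le_card_sdiff_add_card
  have hcard : H.card ≤ (H \ configurationEdges H (2 * r - t - 1) 2).card +
      (configurationEdges H (2 * r - t - 1) 2).card := card_le_card_sdiff_add_card
  have htotal : G.card ≤ (H \ configurationEdges H (2 * r - t - 1) 2).card + 5 * n ^ (t - 1) := by
    omega
  rw [sub_le_iff_le_add]
  exact_mod_cast htotal
end

section
/- Let r ≥ 3 and t be integers with 2 ≤ t ≤ r−1 and (r,t) ≠ (3,2). Every r-graph on n vertices which is (4r−3t, 4)-free, (3r−2t−1, 3)-free and (2r−t−1, 2)-free has at most C(n,t)/C(r,t) edges, where C(a,b) denotes the binomial coefficient a choose b. -/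
open Finset Filter

/-- A maximal matching of a relation on a finite set: `P` is a set of disjoint related
pairs, and no two of the leftover elements `R` are related. -/
lemma exists_maximal_matching {α : Type*} [DecidableEq α] (adj : α → α → Prop) (G : Finset α) :
    ∃ (P : Finset (α × α)) (R : Finset α), R ⊆ G ∧
      (∀ p ∈ P, p.1 ∈ G ∧ p.2 ∈ G ∧ p.1 ≠ p.2 ∧ adj p.1 p.2) ∧
      (∀ p ∈ P, ∀ q ∈ P, p ≠ q → p.1 ≠ q.1 ∧ p.1 ≠ q.2 ∧ p.2 ≠ q.1 ∧ p.2 ≠ q.2) ∧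
      (∀ p ∈ P, ∀ c ∈ R, p.1 ≠ c ∧ p.2 ≠ c) ∧
      (∀ c ∈ R, ∀ d ∈ R, c ≠ d → ¬ adj c d) ∧
      G.card = 2 * P.card + R.card := by
  induction G using Finset.strongInduction with
  | H G ih =>
    by_cases h : ∃ a ∈ G, ∃ b ∈ G, a ≠ b ∧ adj a b
    · obtain ⟨a, ha, b, hb, hab, hadj⟩ := h
      have hb' : b ∈ G.erase a := mem_erase.2 ⟨hab.symm, hb⟩
      obtain ⟨P, R, hR, hP, hPP, hPR, hRR, hcard⟩ := ih ((G.erase a).erase b)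
        ((erase_ssubset hb').trans (erase_ssubset ha))
      have hmem : ∀ x ∈ (G.erase a).erase b, x ≠ a ∧ x ≠ b ∧ x ∈ G := by
        intro x hx
        simp only [mem_erase] at hx
        tauto
      have hnot : (a, b) ∉ P := fun h => (hmem _ (hP _ h).1).1 rfl
      refine ⟨insert (a, b) P, R, fun x hx => (hmem x (hR hx)).2.2, ?_, ?_, ?_, hRR, ?_⟩
      · intro p hp
        rcases mem_insert.1 hp with rfl | hp
        · exact ⟨ha, hb, hab, hadj⟩
        · obtain ⟨h1, h2, h3⟩ := hP p hp
          exact ⟨(hmem _ h1).2.2, (hmem _ h2).2.2, h3⟩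
      · intro p hp q hq hpq
        rcases mem_insert.1 hp with rfl | hp <;> rcases mem_insert.1 hq with rfl | hq
        · exact absurd rfl hpq
        · obtain ⟨h1, h2, -⟩ := hP q hq
          have := hmem _ h1
          have := hmem _ h2
          grind
        · obtain ⟨h1, h2, -⟩ := hP p hp
          have := hmem _ h1
          have := hmem _ h2
          grind
        · exact hPP p hp q hq hpq
      · intro p hp c hc
        rcases mem_insert.1 hp with rfl | hp
        · have := hmem _ (hR hc)
          exact ⟨this.1.symm, this.2.1.symm⟩
        · exact hPR p hp c hc
      · rw [card_insert_of_notMem hnot]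
        have h1 := card_erase_add_one ha
        have h2 := card_erase_add_one hb'
        omega
    · push Not at h
      exact ⟨∅, G, Subset.rfl, by simp, by simp, by simp, h, by simp⟩

lemma choose_succ_add_mul_choose_le (m k j : ℕ) :
    m.choose (k + 1) + j * m.choose k ≤ (m + j).choose (k + 1) := by
  induction j with
  | zero => simp
  | succ j ih =>
    have h1 := Nat.choose_succ_succ (m + j) k
    have h2 := Nat.choose_le_choose k (Nat.le_add_right m j)
    rw [← add_assoc, h1]
    linarith

lemma two_mul_choose_lt_choose {r t : ℕ} (hr : 3 ≤ r) (ht : 2 ≤ t) (htr : t < r)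
    (hne : ¬(r = 3 ∧ t = 2)) : 2 * r.choose t < (2 * r - t).choose t := by
  obtain ⟨k, rfl⟩ : ∃ k, t = k + 1 := ⟨t - 1, by omega⟩
  obtain ⟨s, rfl⟩ : ∃ s, r = k + 1 + s := ⟨r - (k + 1), by omega⟩
  have hs : 1 ≤ s := by omega
  have hk : 1 ≤ k := by omega
  have hsk : 2 ≤ s * k := by
    by_contra! h
    have : s ≤ s * k := Nat.le_mul_of_pos_right s hk
    have : k ≤ s * k := Nat.le_mul_of_pos_left k hs
    exact hne ⟨by omega, by omega⟩
  have e : 2 * (k + 1 + s) - (k + 1) = k + 1 + s + s := by omega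
  rw [e]
  have h1 := choose_succ_add_mul_choose_le (k + 1 + s) k s
  have h2 := choose_succ_add_mul_choose_le (k + 1) k s
  have h3 := Nat.choose_succ_right_eq (k + 1 + s) k
  have e2 : k + 1 + s - k = s + 1 := by omega
  rw [e2] at h3
  rw [Nat.choose_self, Nat.choose_succ_self_right] at h2
  generalize (k + 1 + s).choose (k + 1) = Y at *
  generalize (k + 1 + s).choose k = X at *
  have h4 : Y < s * X := by
    have h5 : s + 1 ≤ Y := by nlinarith
    have h6 : (s + 1) * (s * X) = s * k * Y + s * Y := by
      calc (s + 1) * (s * X) = s * (X * (s + 1)) := by ring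
        _ = s * k * Y + s * Y := by rw [← h3]; ring
    have h7 : 2 * Y ≤ s * k * Y := Nat.mul_le_mul_right _ hsk
    by_contra! h8
    have := Nat.mul_le_mul_left (s + 1) h8
    linarith
  omega

lemma card_union_three_lower {V : Type*} [DecidableEq V] {G : Finset (Finset V)} {s : ℕ}
    (h : IsFree G s 3) {a b c : Finset V} (ha : a ∈ G) (hb : b ∈ G) (hc : c ∈ G)
    (hab : a ≠ b) (hac : a ≠ c) (hbc : b ≠ c) : s < (a ∪ b ∪ c).card := by
  by_contra! hle
  refine h ⟨{a, b, c}, by grind, card_eq_three.2 ⟨a, b, c, hab, hac, hbc, rfl⟩, ?_⟩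
  simpa [sup_insert, union_assoc] using hle

lemma card_union_two_lower {V : Type*} [DecidableEq V] {G : Finset (Finset V)} {s : ℕ}
    (h : IsFree G s 2) {a b : Finset V} (ha : a ∈ G) (hb : b ∈ G)
    (hab : a ≠ b) : s < (a ∪ b).card := by
  by_contra! hle
  refine h ⟨{a, b}, by grind, card_pair hab, ?_⟩
  simpa [sup_insert] using hle

lemma card_union_four_lower {V : Type*} [DecidableEq V] {G : Finset (Finset V)} {s : ℕ}
    (h : IsFree G s 4) {a b c d : Finset V} (ha : a ∈ G) (hb : b ∈ G) (hc : c ∈ G) (hd : d ∈ G)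
    (hab : a ≠ b) (hac : a ≠ c) (had : a ≠ d) (hbc : b ≠ c) (hbd : b ≠ d) (hcd : c ≠ d) :
    s < (a ∪ b ∪ (c ∪ d)).card := by
  by_contra! hle
  refine h ⟨{a, b, c, d}, by grind, by grind, ?_⟩
  simpa [sup_insert, union_assoc] using hle

/-- Every `r`-graph on `n` vertices ((r,t) ≠ (3,2)) which is `(4r-3t, 4)`-free,
`(3r-2t-1, 3)`-free and `(2r-t-1, 2)`-free has at most `C(n,t)/C(r,t)` edges. -/
theorem upper_bound_count (r t n : ℕ) (hr : 3 ≤ r) (ht : 2 ≤ t) (htr : t ≤ r - 1)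
    (hne : ¬(r = 3 ∧ t = 2))
    (G : Finset (Finset (Fin n))) (hG : ∀ e ∈ G, e.card = r)
    (h4 : IsFree G (4 * r - 3 * t) 4)
    (h3 : IsFree G (3 * r - 2 * t - 1) 3)
    (h2 : IsFree G (2 * r - t - 1) 2) :
    (G.card : ℝ) ≤ (n.choose t : ℝ) / (r.choose t : ℝ) := by
  have htr' : t < r := by omega
  obtain ⟨P, R, hR, hP, hPP, hPR, hRR, hcard⟩ :=
    exists_maximal_matching (fun a b : Finset (Fin n) => t ≤ (a ∩ b).card) G
  have hpair : ∀ p ∈ P, (p.1 ∪ p.2).card = 2 * r - t := by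
    intro p hp
    obtain ⟨ha, hb, hab, hadj⟩ := hP p hp
    have h := card_union_two_lower h2 ha hb hab
    have := card_union_add_card_inter p.1 p.2
    rw [hG _ ha, hG _ hb] at this
    omega
  have hinter : ∀ p ∈ P, ∀ c ∈ R, ((p.1 ∪ p.2) ∩ c).card ≤ t := by
    intro p hp c hc
    obtain ⟨ha, hb, hab, -⟩ := hP p hp
    have h := card_union_three_lower h3 ha hb (hR hc) hab (hPR p hp c hc).1 (hPR p hp c hc).2
    have := card_union_add_card_inter (p.1 ∪ p.2) c
    rw [hG _ (hR hc), hpair p hp] at this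
    omega
  set A : Finset (Finset (Fin n)) := R.biUnion (powersetCard t) with hA
  have hAcard : A.card = R.card * r.choose t := by
    rw [hA, card_biUnion, sum_const_nat]
    · intro c hc
      rw [card_powersetCard, hG _ (hR hc)]
    · intro c hc d hd hcd
      rw [Function.onFun, Finset.disjoint_left]
      intro T hT hT'
      rw [mem_powersetCard] at hT hT'
      refine hRR c hc d hd hcd ?_
      rw [← hT.2]
      exact card_le_card (subset_inter hT.1 hT'.1)
  have hle_one : ∀ p ∈ P, (A ∩ powersetCard t (p.1 ∪ p.2)).card ≤ 1 := by
    intro p hp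
    obtain ⟨ha, hb, hab, -⟩ := hP p hp
    rw [card_le_one]
    intro T hT T' hT'
    simp only [hA, mem_inter, mem_biUnion, mem_powersetCard] at hT hT'
    obtain ⟨⟨c, hc, hTc, hTt⟩, hTp, -⟩ := hT
    obtain ⟨⟨d, hd, hTd, hTt'⟩, hTp', -⟩ := hT'
    have key1 := subset_inter hTp hTc
    have key2 := subset_inter hTp' hTd
    by_cases hcd : c = d
    · subst hcd
      rw [eq_of_subset_of_card_le key1 (by rw [hTt]; exact hinter p hp c hc),
        eq_of_subset_of_card_le key2 (by rw [hTt']; exact hinter p hp c hc)]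
    · exfalso
      have h := card_union_four_lower h4 ha hb (hR hc) (hR hd) hab (hPR p hp c hc).1
        (hPR p hp d hd).1 (hPR p hp c hc).2 (hPR p hp d hd).2 hcd
      rw [← union_assoc] at h
      have e1 := card_union_add_card_inter (p.1 ∪ p.2) c
      have e2 := card_union_add_card_inter (p.1 ∪ p.2 ∪ c) d
      have e3 := card_le_card key1
      have e4 := card_le_card
        (key2.trans (inter_subset_inter_right (subset_union_left (s₂ := c))))
      rw [hG _ (hR hc), hpair p hp] at e1
      rw [hG _ (hR hd)] at e2
      omega
  set B : Finset (Finset (Fin n)) := P.biUnion fun p => powersetCard t (p.1 ∪ p.2) \ A with hB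
  have hBcard : P.card * (2 * r.choose t) ≤ B.card := by
    rw [hB, card_biUnion, ← smul_eq_mul]
    · refine card_nsmul_le_sum _ _ _ fun p hp => ?_
      rw [card_sdiff, card_powersetCard, hpair p hp]
      have := hle_one p hp
      have := two_mul_choose_lt_choose hr ht htr' hne
      omega
    · intro p hp q hq hpq
      rw [Function.onFun, Finset.disjoint_left]
      intro T hT hT'
      rw [Finset.mem_sdiff, mem_powersetCard] at hT hT'
      obtain ⟨ha, hb, hab, -⟩ := hP p hp
      obtain ⟨hc, hd, hcd, -⟩ := hP q hq
      obtain ⟨n1, n2, n3, n4⟩ := hPP p hp q hq hpq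
      have h := card_union_four_lower h4 ha hb hc hd hab n1 n2 n3 n4 hcd
      have e1 := card_union_add_card_inter (p.1 ∪ p.2) (q.1 ∪ q.2)
      have e2 := card_le_card (subset_inter hT.1.1 hT'.1.1)
      rw [hpair p hp, hpair q hq] at e1
      omega
  have hdisj : Disjoint A B := by
    rw [hB, disjoint_biUnion_right]
    exact fun p _ => disjoint_sdiff
  have hsub : A ∪ B ⊆ powersetCard t univ := by
    intro T hT
    simp only [hA, hB, mem_union, mem_biUnion, Finset.mem_sdiff, mem_powersetCard] at hT
    rw [mem_powersetCard]
    refine ⟨subset_univ _, ?_⟩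
    rcases hT with ⟨_, _, _, h⟩ | ⟨_, _, ⟨_, h⟩, _⟩ <;> exact h
  have htotal := card_le_card hsub
  rw [card_union_of_disjoint hdisj, card_powersetCard, card_univ, Fintype.card_fin] at htotal
  rw [le_div_iff₀ (by exact_mod_cast Nat.choose_pos htr'.le)]
  have : G.card * r.choose t ≤ n.choose t := by
    rw [hcard]
    linarith
  exact_mod_cast this
end

section
/- For all integers r ≥ 3 and t with 2 ≤ t ≤ r−1, the binomial coefficient C(2r−t, t) is at least 2·C(r,t); moreover, equality holds if and only if (r,t) = (3,2). -/
/-- Increasing `t` keeps `2 * C(t + d, t) ≤ C(t + 2d, t)` and makes it strict. -/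
lemma two_mul_choose_lt_of_le {t d : ℕ} (hd : 1 ≤ d)
    (h : 2 * (t + d).choose t ≤ (t + 2 * d).choose t) :
    2 * (t + 1 + d).choose (t + 1) < (t + 1 + 2 * d).choose (t + 1) := by
  have h₁ := Nat.add_one_mul_choose_eq (t + d) t
  have h₂ := Nat.add_one_mul_choose_eq (t + 2 * d) t
  have hpos : 0 < (t + d).choose t := Nat.choose_pos (Nat.le_add_right t d)
  rw [show t + 1 + d = t + d + 1 by ring, show t + 1 + 2 * d = t + 2 * d + 1 by ring]
  refine lt_of_mul_lt_mul_right (a := t + 1) ?_ (Nat.zero_le _)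
  rw [mul_assoc, ← h₁, ← h₂]
  nlinarith [Nat.mul_le_mul_left (t + 2 * d + 1) h, Nat.mul_pos hd hpos]

lemma choose_two_add_two_mul (d : ℕ) : (2 + 2 * d).choose 2 = (d + 1) * (2 * d + 1) := by
  rw [Nat.choose_two_right, show 2 + 2 * d - 1 = 2 * d + 1 by lia]
  exact Nat.div_eq_of_eq_mul_left two_pos (by ring)

lemma two_mul_choose_two_add (d : ℕ) : 2 * (2 + d).choose 2 = (d + 1) * (d + 2) := by
  have h := Nat.add_one_mul_choose_eq (d + 1) 1
  rw [Nat.choose_one_right] at h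
  rw [show 2 + d = d + 1 + 1 by ring]
  linarith

lemma two_mul_choose_le {t d : ℕ} (ht : 2 ≤ t) (hd : 1 ≤ d) :
    2 * (t + d).choose t ≤ (t + 2 * d).choose t := by
  induction t, ht using Nat.le_induction with
  | base =>
    rw [choose_two_add_two_mul, two_mul_choose_two_add]
    exact Nat.mul_le_mul_left _ (by lia)
  | succ t _ ih => exact (two_mul_choose_lt_of_le hd ih).le

lemma choose_eq_two_mul_choose_iff {t d : ℕ} (ht : 2 ≤ t) (hd : 1 ≤ d) :
    (t + 2 * d).choose t = 2 * (t + d).choose t ↔ d = 1 ∧ t = 2 := by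
  obtain rfl | ht' := ht.eq_or_lt
  · rw [choose_two_add_two_mul, two_mul_choose_two_add, Nat.mul_right_inj (Nat.succ_ne_zero d)]
    lia
  · obtain ⟨s, rfl⟩ := Nat.exists_eq_add_of_le' (show 1 ≤ t by lia)
    have h := two_mul_choose_lt_of_le hd (two_mul_choose_le (t := s) (by lia) hd)
    exact ⟨fun h' => absurd h' h.ne', fun h' => by lia⟩

/-- For all `r ≥ 3` and `2 ≤ t ≤ r-1`, we have `C(2r-t, t) ≥ 2·C(r,t)`, with equality iff
`(r,t) = (3,2)`. -/
theorem choose_inequality (r t : ℕ) (hr : 3 ≤ r) (ht : 2 ≤ t) (htr : t ≤ r - 1) :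
    2 * r.choose t ≤ (2 * r - t).choose t ∧
      ((2 * r - t).choose t = 2 * r.choose t ↔ r = 3 ∧ t = 2) := by
  obtain ⟨d, rfl⟩ := Nat.exists_eq_add_of_le (show t ≤ r by lia)
  have hd : 1 ≤ d := by lia
  rw [show 2 * (t + d) - t = t + 2 * d by lia, choose_eq_two_mul_choose_iff ht hd]
  exact ⟨two_mul_choose_le ht hd, by lia⟩
end
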